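/- If (X_n)_{n≥1} is a stationary and ergodic process taking values in S with X_1 ~ P, then for every D, almost surely liminf_{n→∞} R(P_{X_1^n}, Q, D) = R(P,Q,D), where P_{x_1^n} denotes the empirical distribution on S of x_1^n. -/

import Mathlib

open MeasureTheory Filter Set Topology Classical
open scoped ENNReal NNReal

noncomputable section

/-- `-log t` as a value in `ℝ≥0∞` (equal to `∞` when `t = 0`); intended for `t ≤ 1`. -/
def negLog (t : ℝ≥0∞) : ℝ≥0∞ :=
  if t = 0 then ∞ else ENNReal.ofReal (-Real.log t.toReal)

/-- `log t` as a value in `ℝ≥0∞` (equal to `∞` when `t = ∞`); intended for `t ≥ 1`. -/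
def posLog (t : ℝ≥0∞) : ℝ≥0∞ :=
  if t = ∞ then ∞ else ENNReal.ofReal (Real.log t.toReal)

/-- The extended-real-valued logarithm of an `ℝ≥0∞` number. -/
def eLog (t : ℝ≥0∞) : EReal :=
  if t = 0 then ⊥ else if t = ∞ then ⊤ else ((Real.log t.toReal : ℝ) : EReal)

/-- Relative entropy `H(μ‖ν)` (in nats), valued in `ℝ≥0∞`: it equals
`∫ log (dμ/dν) dμ` when `μ ≪ ν` (and `+∞` when this integral is not defined,
which for probability measures can only mean `+∞`), and `+∞` when `¬ μ ≪ ν`. -/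
def relEnt {α : Type*} [MeasurableSpace α] (μ ν : Measure α) : ℝ≥0∞ :=
  if μ ≪ ν ∧ Integrable (llr μ ν) μ then ENNReal.ofReal (∫ x, llr μ ν x ∂μ) else ∞

/-- The set `W(P,D)` of couplings: probability measures on `S × T` with first
marginal `P` and expected distortion at most `D`. -/
def distSet {S T : Type*} [MeasurableSpace S] [MeasurableSpace T]
    (ρ : S × T → ℝ) (P : Measure S) (D : ℝ) : Set (Measure (S × T)) :=
  {W | IsProbabilityMeasure W ∧ W.map Prod.fst = P ∧
    ((∫⁻ z, ENNReal.ofReal (ρ z) ∂W : ℝ≥0∞) : EReal) ≤ ((D : ℝ) : EReal)}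

/-- The rate function `R(P,Q,D) = inf_{W ∈ W(P,D)} H(W‖P×Q)` (equal to `+∞`
when `W(P,D)` is empty). -/
def Rrate {S T : Type*} [MeasurableSpace S] [MeasurableSpace T]
    (ρ : S × T → ℝ) (P : Measure S) (Q : Measure T) (D : ℝ) : ℝ≥0∞ :=
  ⨅ W ∈ distSet ρ P D, relEnt W (P.prod Q)

/-- `Λ(P,Q,λ) = E_X[log E_Y e^{λρ(X,Y)}]`, valued in `EReal`.
For `λ ≥ 0` the integrand lies in `[0,∞]`; for `λ < 0` it lies in `[-∞,0]`. -/
def Lam {S T : Type*} [MeasurableSpace S] [MeasurableSpace T]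
    (ρ : S × T → ℝ) (P : Measure S) (Q : Measure T) (l : ℝ) : EReal :=
  if 0 ≤ l then
    ((∫⁻ x, posLog (∫⁻ y, ENNReal.ofReal (Real.exp (l * ρ (x, y))) ∂Q) ∂P : ℝ≥0∞) : EReal)
  else
    -(((∫⁻ x, negLog (∫⁻ y, ENNReal.ofReal (Real.exp (l * ρ (x, y))) ∂Q) ∂P : ℝ≥0∞) : EReal))

/-- The Fenchel–Legendre transform `Λ*(P,Q,D) = sup_{λ ≤ 0} [λD - Λ(P,Q,λ)]`. -/
def LamStar {S T : Type*} [MeasurableSpace S] [MeasurableSpace T]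
    (ρ : S × T → ℝ) (P : Measure S) (Q : Measure T) (D : ℝ) : EReal :=
  ⨆ l ∈ Iic (0 : ℝ), (((l * D : ℝ) : EReal) - Lam ρ P Q l)

/-- `ρ_Q(x) := essinf_{Y ∼ Q} ρ(x,Y)`. -/
def rhoQ {S T : Type*} [MeasurableSpace T]
    (ρ : S × T → ℝ) (Q : Measure T) (x : S) : ℝ :=
  essInf (fun y => ρ (x, y)) Q

/-- `D_min(P,Q) := inf {D : Λ*(P,Q,D) < ∞}`. -/
def DminPQ {S T : Type*} [MeasurableSpace S] [MeasurableSpace T]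
    (ρ : S × T → ℝ) (P : Measure S) (Q : Measure T) : ℝ :=
  sInf {D : ℝ | LamStar ρ P Q D ≠ ⊤}

/-- `D_ave(P,Q) := E ρ(X,Y)` for independent `X ∼ P`, `Y ∼ Q`, valued in `ℝ≥0∞`. -/
def DavePQ {S T : Type*} [MeasurableSpace S] [MeasurableSpace T]
    (ρ : S × T → ℝ) (P : Measure S) (Q : Measure T) : ℝ≥0∞ :=
  ∫⁻ z, ENNReal.ofReal (ρ z) ∂(P.prod Q)

/-- The candidate derivative `Λ'(λ)` of `Λ(P,Q,·)`. -/
def LamD {S T : Type*} [MeasurableSpace S] [MeasurableSpace T]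
    (ρ : S × T → ℝ) (P : Measure S) (Q : Measure T) (l : ℝ) : ℝ :=
  ∫ x, (∫ y, ρ (x, y) * Real.exp (l * ρ (x, y)) ∂Q) /
    (∫ y, Real.exp (l * ρ (x, y)) ∂Q) ∂P

/-- The left shift on sequences. -/
def shiftSeq {α : Type*} (x : ℕ → α) (n : ℕ) : α := x (n + 1)

/-- The single-letter distortion measure `ρ_n` on `n`-strings. -/
def rhoFin {S T : Type*} (ρ : S × T → ℝ) (n : ℕ) (x : Fin n → S) (y : Fin n → T) : ℝ :=
  (n : ℝ)⁻¹ * ∑ k, ρ (x k, y k)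

/-- `L_n(x_1^n, Q^n, D) = -(1/n) log Q^n(B_n(x_1^n,D))`, valued in `ℝ≥0∞`,
for a memoryless (product) codebook distribution `Q^n`. -/
def LnIID {S T : Type*} [MeasurableSpace T]
    (ρ : S × T → ℝ) (Q : Measure T) (D : ℝ) (n : ℕ) (x : ℕ → S) : ℝ≥0∞ :=
  (n : ℝ≥0∞)⁻¹ *
    negLog ((Measure.pi fun _ : Fin n => Q) {y | rhoFin ρ n (fun k => x k) y ≤ D})

/-- The empirical distribution `P_{x_1^n} = (1/n) ∑_{k=1}^n δ_{x_k}`. -/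
def empMeas {S : Type*} [MeasurableSpace S] (n : ℕ) (x : ℕ → S) : Measure S :=
  (n : ℝ≥0∞)⁻¹ • ∑ k ∈ Finset.range n, Measure.dirac (x k)

/-- The `n`-dimensional marginal of a measure on sequences. -/
def margN {α : Type*} [MeasurableSpace α] (μ : Measure (ℕ → α)) (n : ℕ) :
    Measure (Fin n → α) :=
  μ.map fun x (k : Fin n) => x (k : ℕ)

/-- The strong mixing condition `C⁻¹ 𝒬(A) 𝒬(B) ≤ 𝒬(A ∩ B) ≤ C 𝒬(A) 𝒬(B)` for all
`A ∈ σ(Y_1^n)`, `B ∈ σ(Y_{n+1}^∞)` and all `n`. -/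
def Mixing {T : Type*} [MeasurableSpace T] (𝒬 : Measure (ℕ → T)) (C : ℝ) : Prop :=
  ∀ (n : ℕ) (A B : Set (ℕ → T)),
    MeasurableSet[MeasurableSpace.comap (fun y (k : Fin n) => y (k : ℕ)) inferInstance] A →
    MeasurableSet[MeasurableSpace.comap (fun y (k : ℕ) => y (k + n)) inferInstance] B →
    (ENNReal.ofReal C)⁻¹ * (𝒬 A * 𝒬 B) ≤ 𝒬 (A ∩ B) ∧
      𝒬 (A ∩ B) ≤ ENNReal.ofReal C * (𝒬 A * 𝒬 B)

/-- `L_n(x_1^n, Q_n, D) = -(1/n) log Q_n(B_n(x_1^n,D))` where `Q_n` is the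
`n`-dimensional marginal of the codebook process law `𝒬`. -/
def LnMem {S T : Type*} [MeasurableSpace T]
    (ρ : S × T → ℝ) (𝒬 : Measure (ℕ → T)) (D : ℝ) (n : ℕ) (x : ℕ → S) : ℝ≥0∞ :=
  (n : ℝ≥0∞)⁻¹ * negLog (margN 𝒬 n {y | rhoFin ρ n (fun k => x k) y ≤ D})

/-- The set `W_n(P_n,D)` of couplings on `S^n × T^n`. -/
def distSetN {S T : Type*} [MeasurableSpace S] [MeasurableSpace T]
    (ρ : S × T → ℝ) (n : ℕ) (Pn : Measure (Fin n → S)) (D : ℝ) :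
    Set (Measure ((Fin n → S) × (Fin n → T))) :=
  {W | IsProbabilityMeasure W ∧ W.map Prod.fst = Pn ∧
    ((∫⁻ z, ENNReal.ofReal (rhoFin ρ n z.1 z.2) ∂W : ℝ≥0∞) : EReal) ≤ ((D : ℝ) : EReal)}

/-- `R_n(P_n,Q_n,D) = (1/n) inf_{W_n ∈ W_n(P_n,D)} H(W_n‖P_n×Q_n)`. -/
def RnMem {S T : Type*} [MeasurableSpace S] [MeasurableSpace T]
    (ρ : S × T → ℝ) (n : ℕ) (Pn : Measure (Fin n → S)) (Qn : Measure (Fin n → T))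
    (D : ℝ) : ℝ≥0∞ :=
  (n : ℝ≥0∞)⁻¹ * ⨅ W ∈ distSetN ρ n Pn D, relEnt W (Pn.prod Qn)

/-- `Λ_n(P_n,Q_n,λ) = E_{X_1^n}[log E_{Y_1^n} e^{λ ρ_n(X_1^n,Y_1^n)}]`. -/
def LamN {S T : Type*} [MeasurableSpace S] [MeasurableSpace T]
    (ρ : S × T → ℝ) (n : ℕ) (Pn : Measure (Fin n → S)) (Qn : Measure (Fin n → T))
    (l : ℝ) : EReal :=
  Lam (fun z => rhoFin ρ n z.1 z.2) Pn Qn l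

/-- `Λ_n*(P_n,Q_n,D) = (1/n) sup_{λ ≤ 0} [λD - Λ_n(P_n,Q_n,λ)]`. -/
def LamStarN {S T : Type*} [MeasurableSpace S] [MeasurableSpace T]
    (ρ : S × T → ℝ) (n : ℕ) (Pn : Measure (Fin n → S)) (Qn : Measure (Fin n → T))
    (D : ℝ) : EReal :=
  (((n : ℝ)⁻¹ : ℝ) : EReal) *
    ⨆ l ∈ Iic (0 : ℝ), (((l * D : ℝ) : EReal) - LamN ρ n Pn Qn l)

/-- One-sided Fenchel–Legendre transform `D ↦ sup_{λ ≤ 0} [λD - Λ(λ)]` of a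
function `Λ : ℝ → EReal`. -/
def FLT (L : ℝ → EReal) (D : ℝ) : EReal :=
  ⨆ l ∈ Iic (0 : ℝ), (((l * D : ℝ) : EReal) - L l)

/-- Running minima of Birkhoff sums (including the empty sum). -/
def erJ {α : Type*} (T : α → α) (g : α → ℝ) : ℕ → α → ℝ
  | 0 => fun _ => 0
  | n + 1 => fun x => min 0 (g x + erJ T g n (T x))

set_option linter.unusedSectionVars false

section erg
variable {α : Type*} [MeasurableSpace α] {μ : Measure α} {T : α → α} {g : α → ℝ}

lemma erJ_succ_le (n : ℕ) : ∀ x, erJ T g (n + 1) x ≤ erJ T g n x := by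
  induction n with
  | zero => intro x; simp [erJ]
  | succ n ih =>
    intro x
    have := ih (T x)
    change min 0 (g x + erJ T g (n + 1) (T x)) ≤ min 0 (g x + erJ T g n (T x))
    exact min_le_min le_rfl (by linarith)

lemma erJ_le_zero (n : ℕ) (x : α) : erJ T g n x ≤ 0 := by
  cases n <;> simp [erJ]

lemma erJ_le_birkhoffSum (n : ℕ) : ∀ x, erJ T g n x ≤ birkhoffSum T g n x := by
  induction n with
  | zero => intro x; simp [erJ]
  | succ n ih =>
    intro x
    rw [birkhoffSum_succ', erJ]
    exact (min_le_right _ _).trans (by linarith [ih (T x)])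

lemma erJ_measurable (hT : Measurable T) (hg : Measurable g) (n : ℕ) :
    Measurable (erJ T g n) := by
  induction n with
  | zero => exact measurable_const
  | succ n ih => exact measurable_const.min (hg.add (ih.comp hT))

lemma erJ_integrable [IsProbabilityMeasure μ] (hT : MeasurePreserving T μ μ)
    (hi : Integrable g μ) (n : ℕ) :
    Integrable (erJ T g n) μ := by
  induction n with
  | zero => exact integrable_zero _ _ _
  | succ n ih =>
    exact (integrable_zero _ _ _).inf (hi.add (hT.integrable_comp_of_integrable ih))

lemma ergodic_bddBelow [IsProbabilityMeasure μ] (hT : Ergodic T μ)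
    (hg : Measurable g) (hi : Integrable g μ) (hpos : 0 < ∫ x, g x ∂μ) :
    ∀ᵐ x ∂μ, ∃ C : ℝ, ∀ n, -C ≤ birkhoffSum T g n x := by
  set A : Set α := {x | ∀ N : ℕ, ∃ n, erJ T g n x < -(N : ℝ)} with hA
  have hAm : MeasurableSet A := by
    have : A = ⋂ N : ℕ, ⋃ n, {x | erJ T g n x < -(N : ℝ)} := by ext; simp [hA]
    rw [this]
    exact MeasurableSet.iInter fun N => MeasurableSet.iUnion fun n =>
      measurableSet_lt (erJ_measurable hT.measurable hg n) measurable_const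
  have hAinv : T ⁻¹' A = A := by
    ext x
    constructor
    · intro h N
      obtain ⟨M, hM⟩ := exists_nat_ge (N + g x)
      obtain ⟨n, hn⟩ := h M
      refine ⟨n + 1, ?_⟩
      rw [erJ]
      exact (min_le_right _ _).trans_lt (by linarith)
    · intro h N
      obtain ⟨M, hM⟩ := exists_nat_ge (N - g x)
      obtain ⟨n, hn⟩ := h M
      cases n with
      | zero => 
        have : (0 : ℝ) ≤ M := by positivity
        simp only [erJ] at hn
        linarith
      | succ n =>
        refine ⟨n, ?_⟩
        rw [erJ, min_lt_iff] at hn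
        rcases hn with hn | hn
        · have : (0 : ℝ) ≤ M := by positivity
          linarith
        · linarith
  rcases hT.toPreErgodic.ae_empty_or_univ hAm hAinv with h | h
  · have h' : ∀ᵐ x ∂μ, x ∉ A := by
      filter_upwards [h] with x hx hxA
      have : (A x) = (∅ : Set α) x := hx
      exact (this ▸ hxA : (∅ : Set α) x)
    filter_upwards [h'] with x hx
    simp only [hA, mem_ofPred_eq, not_forall, not_exists, not_lt] at hx
    obtain ⟨N, hN⟩ := hx
    exact ⟨N, fun n => (hN n).trans (erJ_le_birkhoffSum n x)⟩
  · exfalso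
    have h' : ∀ᵐ x ∂μ, x ∈ A := by
      filter_upwards [h] with x hx
      have : (A x) = (univ : Set α) x := hx
      exact (this ▸ trivial : A x)
    have key : Tendsto (fun n => ∫ x, max 0 (g x + erJ T g n (T x)) ∂μ) atTop (𝓝 (∫ _, (0 : ℝ) ∂μ)) := by
      refine tendsto_integral_of_dominated_convergence (fun x => |g x|) ?_ hi.abs ?_ ?_
      · intro n
        exact (measurable_const.max (hg.add ((erJ_measurable hT.measurable hg n).comp hT.measurable))).aestronglyMeasurable
      · intro n
        refine Eventually.of_forall fun x => ?_
        rw [Real.norm_eq_abs, abs_of_nonneg (le_max_left _ _)]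
        exact max_le (abs_nonneg _) (by linarith [erJ_le_zero (T := T) (g := g) n (T x), le_abs_self (g x)])
      · filter_upwards [h'] with x hx
        have hx' : T x ∈ A := by rw [← hAinv] at hx; exact hx
        obtain ⟨M, hM⟩ := exists_nat_ge (g x)
        obtain ⟨n, hn⟩ := hx' M
        refine tendsto_const_nhds.congr' ?_
        filter_upwards [eventually_ge_atTop n] with m hm
        have : erJ T g m (T x) ≤ erJ T g n (T x) :=
          antitone_nat_of_succ_le (f := fun n => erJ T g n (T x)) (fun n => erJ_succ_le n _) hm
        rw [max_eq_left (by linarith)]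
    rw [integral_zero] at key
    have hle : ∀ n, ∫ x, g x ∂μ ≤ ∫ x, max 0 (g x + erJ T g n (T x)) ∂μ := by
      intro n
      have hJ := erJ_integrable hT.toMeasurePreserving hi (n := n)
      have hJT := hT.toMeasurePreserving.integrable_comp_of_integrable hJ
      have e1 : ∫ x, erJ T g n (T x) ∂μ = ∫ x, erJ T g n x ∂μ := by
        have := integral_map (μ := μ) hT.measurable.aemeasurable (f := erJ T g n)
          (by rw [hT.map_eq]; exact hJ.aestronglyMeasurable)
        rw [hT.map_eq] at this
        exact this.symm
      have e2 : ∫ x, g x ∂μ = ∫ x, (g x + erJ T g n (T x) - erJ T g n x) ∂μ := by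
        have e3 : ∫ x, (g x + erJ T g n (T x)) ∂μ = ∫ x, g x ∂μ + ∫ x, erJ T g n (T x) ∂μ :=
          integral_add hi hJT
        have e4 : ∫ x, (g x + erJ T g n (T x) - erJ T g n x) ∂μ =
            ∫ x, (g x + erJ T g n (T x)) ∂μ - ∫ x, erJ T g n x ∂μ := integral_sub (hi.add hJT) hJ
        rw [e4, e3, e1]; ring
      rw [e2]
      refine integral_mono ((hi.add hJT).sub hJ) ((integrable_zero _ _ _).sup (hi.add hJT)) fun x => ?_
      have := erJ_succ_le (T := T) (g := g) n x
      rw [erJ] at this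
      change g x + erJ T g n (T x) - erJ T g n x ≤ max 0 (g x + erJ T g n (T x))
      have h3 := min_add_max 0 (g x + erJ T g n (T x))
      linarith
    exact absurd (ge_of_tendsto' key hle) (not_le.2 hpos)

lemma ergodic_lower [IsProbabilityMeasure μ] (hT : Ergodic T μ)
    (hg : Measurable g) (hi : Integrable g μ) :
    ∀ᵐ x ∂μ, ∀ j : ℕ, ∀ᶠ n : ℕ in atTop, 
      (∫ x, g x ∂μ) - 1 / ((j : ℝ) + 1) ≤ (n : ℝ)⁻¹ * birkhoffSum T g n x := by
  rw [ae_all_iff]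
  intro j
  set ε : ℝ := 1 / ((j : ℝ) + 1) / 2 with hε
  have hε0 : 0 < ε := by positivity
  set c := ∫ x, g x ∂μ with hc
  have hi' : Integrable (fun x => g x - (c - ε)) μ := hi.sub (integrable_const _)
  have := ergodic_bddBelow (g := fun x => g x - (c - ε)) hT (hg.sub measurable_const) hi' (by
    rw [integral_sub hi (integrable_const _)]; simp [← hc, hε0])
  filter_upwards [this] with x hx
  obtain ⟨C, hC⟩ := hx
  have hlim : Tendsto (fun n : ℕ => (n : ℝ)⁻¹ * C) atTop (𝓝 0) := by
    simpa using (tendsto_inv_atTop_nhds_zero_nat (𝕜 := ℝ)).mul_const C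
  filter_upwards [hlim.eventually (gt_mem_nhds hε0), eventually_gt_atTop 0] with n hn hn0
  have h1 := hC n
  have h2 : birkhoffSum T (fun x => g x - (c - ε)) n x = birkhoffSum T g n x - n * (c - ε) := by
    simp only [birkhoffSum, Finset.sum_sub_distrib]; simp; ring
  rw [h2] at h1
  have hn' : (0 : ℝ) < n := by exact_mod_cast hn0
  have h3 : (n : ℝ)⁻¹ * (-C) ≤ (n : ℝ)⁻¹ * (birkhoffSum T g n x - n * (c - ε)) :=
    mul_le_mul_of_nonneg_left h1 (by positivity)
  have h4 : (n : ℝ)⁻¹ * (birkhoffSum T g n x - n * (c - ε)) = (n : ℝ)⁻¹ * birkhoffSum T g n x - (c - ε) := by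
    field_simp
  rw [h4] at h3
  have : 1 / ((j : ℝ) + 1) = 2 * ε := by rw [hε]; ring
  rw [this]
  linarith

/-- Birkhoff's pointwise ergodic theorem in the ergodic case. -/
lemma ergodic_tendsto [IsProbabilityMeasure μ] (hT : Ergodic T μ)
    (hg : Measurable g) (hi : Integrable g μ) :
    ∀ᵐ x ∂μ, Tendsto (fun n : ℕ => (n : ℝ)⁻¹ * birkhoffSum T g n x) atTop (𝓝 (∫ x, g x ∂μ)) := by
  filter_upwards [ergodic_lower hT hg hi, ergodic_lower (g := fun x => - g x) hT hg.neg hi.neg] with x h1 h2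
  rw [Metric.tendsto_atTop']
  intro ε hε
  obtain ⟨j, hj⟩ := exists_nat_one_div_lt hε
  obtain ⟨N, hN⟩ := eventually_atTop.1 ((h1 j).and (h2 j))
  refine ⟨N, fun n hn => ?_⟩
  obtain ⟨a, b⟩ := hN n hn.le
  have e : birkhoffSum T (fun x => - g x) n x = - birkhoffSum T g n x := by
    simp [birkhoffSum]
  rw [e, integral_neg] at b
  rw [Real.dist_eq, abs_lt]
  constructor <;> linarith

lemma ergodic_lintegral_tendsto [IsProbabilityMeasure μ] (hT : Ergodic T μ) {h : α → ℝ≥0∞}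
    (hh : Measurable h) (hi : ∫⁻ x, h x ∂μ ≠ ∞) :
    ∀ᵐ x ∂μ, Tendsto (fun n : ℕ => (n : ℝ≥0∞)⁻¹ * birkhoffSum T h n x) atTop (𝓝 (∫⁻ x, h x ∂μ)) := by
  have hfin : ∀ᵐ x ∂μ, h x < ∞ := ae_lt_top hh hi
  have hfin' : ∀ᵐ x ∂μ, ∀ k, h (T^[k] x) < ∞ := by
    rw [ae_all_iff]
    exact fun k => (hT.toMeasurePreserving.iterate k).quasiMeasurePreserving.ae hfin
  filter_upwards [hfin', ergodic_tendsto hT hh.ennreal_toReal (integrable_toReal_of_lintegral_ne_top hh.aemeasurable hi)] with x hx ht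
  have := ENNReal.tendsto_ofReal ht
  rw [integral_toReal hh.aemeasurable hfin, ENNReal.ofReal_toReal hi] at this
  refine this.congr' ?_
  filter_upwards [eventually_gt_atTop 0] with n hn
  have hn' : (0 : ℝ) < n := by exact_mod_cast hn
  rw [ENNReal.ofReal_mul (by positivity), ENNReal.ofReal_inv_of_pos hn', ENNReal.ofReal_natCast]
  congr 1
  rw [birkhoffSum, birkhoffSum, ENNReal.ofReal_sum_of_nonneg (fun _ _ => ENNReal.toReal_nonneg)]
  exact Finset.sum_congr rfl fun k _ => ENNReal.ofReal_toReal (hx k).ne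

lemma ergodic_lintegral_liminf [IsProbabilityMeasure μ] (hT : Ergodic T μ) {h : α → ℝ≥0∞}
    (hh : Measurable h) :
    ∀ᵐ x ∂μ, ∫⁻ x, h x ∂μ ≤ liminf (fun n : ℕ => (n : ℝ≥0∞)⁻¹ * birkhoffSum T h n x) atTop := by
  have h1 : ∀ N : ℕ, ∀ᵐ x ∂μ, Tendsto (fun n : ℕ => (n : ℝ≥0∞)⁻¹ * birkhoffSum T (fun x => min (h x) N) n x) atTop
      (𝓝 (∫⁻ x, min (h x) N ∂μ)) := by
    intro N
    refine ergodic_lintegral_tendsto hT (hh.min measurable_const) ?_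
    refine ((lintegral_mono (g := fun _ => (N : ℝ≥0∞)) (fun x => min_le_right _ _)).trans_lt ?_).ne
    simp
  have h2 : ∫⁻ x, h x ∂μ = ⨆ N : ℕ, ∫⁻ x, min (h x) N ∂μ := by
    rw [← lintegral_iSup (fun N => hh.min measurable_const)]
    · refine lintegral_congr fun x => ?_
      rw [← inf_iSup_eq]
      simp [ENNReal.iSup_natCast]
    · intro a b hab x
      exact min_le_min le_rfl (by exact_mod_cast hab)
  filter_upwards [ae_all_iff.2 h1] with x hx
  rw [h2]
  refine iSup_le fun N => ?_
  rw [← (hx N).liminf_eq]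
  refine liminf_le_liminf (Eventually.of_forall fun n => ?_)
  gcongr
  exact Finset.sum_le_sum fun _ _ => min_le_left _ _

lemma ergodic_pos_null [IsProbabilityMeasure μ] (hT : Ergodic T μ)
    (hg : Measurable g) (hi : Integrable g μ) (h0 : ∫ x, g x ∂μ ≤ 0) :
    ∀ᵐ x ∂μ, ¬ ∀ n, 0 < n → 0 < birkhoffSum T g n x := by
  set B : Set α := {x | ∀ n, 0 < n → 0 < birkhoffSum T g n x} with hB
  have hSm : ∀ n, Measurable (birkhoffSum T g n) := fun n =>
    Finset.measurable_fun_sum _ fun k _ => hg.comp (hT.measurable.iterate k)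
  have hBm : MeasurableSet B := by
    have : B = ⋂ n : ℕ, ⋂ (_ : 0 < n), {x | 0 < birkhoffSum T g n x} := by ext; simp [hB]
    rw [this]
    exact MeasurableSet.iInter fun N => MeasurableSet.iInter fun n =>
      measurableSet_lt measurable_const (hSm _)
  set C : ℕ → ℕ → Set α := fun m j => {x | x ∈ B ∧ (∀ i, 0 < i → i < m → T^[i] x ∉ B) ∧
    1 / ((j : ℝ) + 1) ≤ birkhoffSum T g m x} with hC
  have hCm : ∀ m j, MeasurableSet (C m j) := by
    intro m j
    have : C m j = B ∩ ((⋂ i : ℕ, ⋂ (_ : 0 < i), ⋂ (_ : i < m), (T^[i] ⁻¹' B)ᶜ) ∩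
      {x | 1 / ((j : ℝ) + 1) ≤ birkhoffSum T g m x}) := by ext; simp [hC]; tauto
    rw [this]
    exact hBm.inter ((MeasurableSet.iInter fun i => MeasurableSet.iInter fun _ =>
      MeasurableSet.iInter fun _ => ((hT.measurable.iterate i) hBm).compl).inter
      (measurableSet_le measurable_const (hSm _)))
  have main : ∀ m j, 0 < m → ∀ᵐ x ∂μ, x ∈ B → T^[m] x ∈ B → x ∉ C m j := by
    intro m j hm
    set ε : ℝ := 1 / ((j : ℝ) + 1) with hε
    have hε0 : 0 < ε := by positivity
    set C' : Set α := C m j ∩ T^[m] ⁻¹' B with hC'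
    have hC'm : MeasurableSet C' := (hCm m j).inter ((hT.measurable.iterate m) hBm)
    set c : α → ℝ := C'.indicator (fun _ => ε) with hc
    have hc0 : ∀ x, 0 ≤ c x := fun x => indicator_nonneg (fun _ _ => hε0.le) x
    have hcε : ∀ x, c x ≤ ε := fun x => indicator_le_self' (fun _ _ => hε0.le) x
    have hcm : Measurable c := measurable_const.indicator hC'm
    have hci : Integrable c μ := (integrable_const _).indicator hC'm
    have claim : ∀ n, ∀ x ∈ B, birkhoffSum T c n x ≤ birkhoffSum T g n x + ε := by
      intro n
      induction n using Nat.strong_induction_on with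
      | _ n ih =>
        intro x hx
        by_cases hex : ∃ k, 0 < k ∧ k < n ∧ T^[k] x ∈ B
        · have hk := Nat.find_spec hex
          have hmin := fun i => Nat.find_min hex (m := i)
          set k := Nat.find hex with hkdef
          obtain ⟨hk0, hkn, hkB⟩ := hk
          obtain ⟨r, hr⟩ := Nat.exists_eq_add_of_lt hkn
          have hn : n = k + (r + 1) := by omega
          have e1 : birkhoffSum T c k x ≤ birkhoffSum T g k x := by
            have : birkhoffSum T c k x = c x := by
              rw [birkhoffSum, Finset.sum_eq_single_of_mem 0 (by simpa using hk0)]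
              · simp
              · intro i hi1 hi0
                apply indicator_of_notMem
                intro hmem
                exact hmin i (by simpa using hi1) ⟨by omega, by simp at hi1; omega, hmem.1.1⟩
            rw [this]
            by_cases hxC : x ∈ C'
            · have hkm : k = m := by
                apply le_antisymm
                · by_contra hlt
                  push Not at hlt
                  exact hmin m hlt ⟨hm, by omega, hxC.2⟩
                · by_contra hlt
                  push Not at hlt
                  exact hxC.1.2.1 k hk0 hlt hkB
              rw [hkm]
              exact (hcε x).trans hxC.1.2.2
            · rw [hc, indicator_of_notMem hxC]
              exact (hx k hk0).le
          rw [hn, birkhoffSum_add T c k (r + 1), birkhoffSum_add T g k (r + 1)]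
          have := ih (r + 1) (by omega) _ hkB
          linarith
        · push Not at hex
          rcases Nat.eq_zero_or_pos n with rfl | hn
          · simp [hε0.le]
          · have : birkhoffSum T c n x = c x := by
              rw [birkhoffSum, Finset.sum_eq_single_of_mem 0 (by simpa using hn)]
              · simp
              · intro i hi1 hi0
                apply indicator_of_notMem
                intro hmem
                exact hex i (by omega) (by simpa using hi1) hmem.1.1
            rw [this]
            linarith [hcε x, hx n hn]
    by_cases hBn : μ B = 0
    · filter_upwards [measure_eq_zero_iff_ae_notMem.1 hBn] with x hx hx'
      exact absurd hx' hx
    · have hfr : ∃ᵐ x ∂μ, x ∈ B := frequently_ae_mem_iff.2 hBn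
      obtain ⟨x, hxB, h1, h2⟩ := (hfr.and_eventually
        ((ergodic_tendsto hT hg hi).and (ergodic_tendsto hT hcm hci))).exists
      have hlim : Tendsto (fun n : ℕ => (n : ℝ)⁻¹ * ε) atTop (𝓝 0) := by
        simpa using (tendsto_inv_atTop_nhds_zero_nat (𝕜 := ℝ)).mul_const ε
      have hle := le_of_tendsto_of_tendsto' h2 (h1.add hlim) (fun n => by
        rw [← mul_add]
        exact mul_le_mul_of_nonneg_left (claim n x hxB) (by positivity))
      rw [hc, integral_indicator hC'm, setIntegral_const, smul_eq_mul] at hle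
      have hz : μ.real C' = 0 := by
        have : 0 ≤ μ.real C' := measureReal_nonneg
        nlinarith
      have hz' : μ C' = 0 := by
        simpa [measureReal_def, ENNReal.toReal_eq_zero_iff] using hz
      filter_upwards [measure_eq_zero_iff_ae_notMem.1 hz'] with x hx hx1 hx2 hx3
      exact hx ⟨hx3, hx2⟩
  have main' : ∀ᵐ x ∂μ, ∀ m j, 0 < m → x ∈ B → T^[m] x ∈ B → x ∉ C m j := by
    rw [ae_all_iff]; intro m
    rw [ae_all_iff]; intro j
    by_cases hm : 0 < m
    · filter_upwards [main m j hm] with x hx _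
      exact hx
    · exact Eventually.of_forall fun x h => absurd h hm
  filter_upwards [main', hT.toMeasurePreserving.conservative.ae_mem_imp_frequently_image_mem
    hBm.nullMeasurableSet] with x h1 h2 hxB
  obtain ⟨n, hn0, hnB⟩ := frequently_atTop.1 (h2 hxB) 1
  have hex : ∃ k, 0 < k ∧ T^[k] x ∈ B := ⟨n, hn0, hnB⟩
  have hk := Nat.find_spec hex
  have hmin := fun i => Nat.find_min hex (m := i)
  set k := Nat.find hex
  obtain ⟨j, hj⟩ := exists_nat_one_div_lt (hxB k hk.1)
  exact h1 k j hk.1 hxB hk.2 ⟨hxB, fun i hi hik hiB => hmin i hik ⟨hi, hiB⟩, hj.le⟩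

lemma ergodic_frequently_nonpos [IsProbabilityMeasure μ] (hT : Ergodic T μ)
    (hg : Measurable g) (hi : Integrable g μ) (h0 : ∫ x, g x ∂μ ≤ 0) :
    ∀ᵐ x ∂μ, ∃ᶠ n in atTop, birkhoffSum T g n x ≤ 0 := by
  have h1 : ∀ᵐ x ∂μ, ∀ N, ¬ ∀ n, 0 < n → 0 < birkhoffSum T g n (T^[N] x) := by
    rw [ae_all_iff]
    exact fun k => (hT.toMeasurePreserving.iterate k).quasiMeasurePreserving.ae
      (ergodic_pos_null hT hg hi h0)
  filter_upwards [h1] with x hx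
  by_contra hcon
  rw [not_frequently] at hcon
  obtain ⟨M, hM⟩ := eventually_atTop.1 hcon
  have hz : birkhoffSum T g 0 x ≤ 0 := by simp
  set N := Nat.findGreatest (fun n => birkhoffSum T g n x ≤ 0) M with hN
  have hN1 : birkhoffSum T g N x ≤ 0 :=
    Nat.findGreatest_spec (P := fun n => birkhoffSum T g n x ≤ 0) (Nat.zero_le M) hz
  refine hx N fun n hn => ?_
  have h2 : ¬ birkhoffSum T g (N + n) x ≤ 0 := by
    by_cases hle : N + n ≤ M
    · exact Nat.findGreatest_is_greatest (P := fun n => birkhoffSum T g n x ≤ 0) (by omega) hle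
    · exact hM _ (by omega)
  rw [birkhoffSum_add] at h2
  linarith

end erg
set_option linter.unusedSectionVars false

section ratefn
variable {S T : Type*} [MeasurableSpace S] [MeasurableSpace T]

open InformationTheory in
lemma relEnt_eq_klDiv {α : Type*} [MeasurableSpace α] (μ ν : Measure α)
    [IsProbabilityMeasure μ] [IsProbabilityMeasure ν] : relEnt μ ν = klDiv μ ν := by
  rw [relEnt, klDiv_def]
  simp

lemma coe_le_iff_ofReal {a : ℝ≥0∞} {D : ℝ} (hD : 0 ≤ D) :
    ((a : ℝ≥0∞) : EReal) ≤ ((D : ℝ) : EReal) ↔ a ≤ ENNReal.ofReal D := by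
  rw [← EReal.coe_ennreal_le_coe_ennreal_iff, EReal.coe_ennreal_ofReal, max_eq_left hD]

open InformationTheory in
lemma Rrate_le_of_density {ρ : S × T → ℝ} (hρm : Measurable ρ)
    (P : Measure S) (Q : Measure T) [IsProbabilityMeasure P] [IsProbabilityMeasure Q]
    {D : ℝ} (hD : 0 ≤ D) {w : S × T → ℝ≥0∞} (hw : Measurable w)
    (hm : ∀ᵐ x ∂P, ∫⁻ y, w (x, y) ∂Q = 1)
    (hd : ∫⁻ x, ∫⁻ y, ENNReal.ofReal (ρ (x, y)) * w (x, y) ∂Q ∂P ≤ ENNReal.ofReal D) :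
    Rrate ρ P Q D ≤ ∫⁻ x, ∫⁻ y, ENNReal.ofReal (klFun (w (x, y)).toReal) ∂Q ∂P := by
  set W := (P.prod Q).withDensity w with hW
  have hW1 : W.map Prod.fst = P := by
    ext A hA
    rw [Measure.map_apply measurable_fst hA, hW, withDensity_apply _ (measurable_fst hA)]
    have : (Prod.fst ⁻¹' A : Set (S × T)) = A ×ˢ univ := by ext; simp
    rw [this, ← Measure.prod_restrict, lintegral_prod _ hw.aemeasurable, Measure.restrict_univ]
    rw [lintegral_congr_ae (ae_restrict_of_ae hm)]
    simp
  have hWp : IsProbabilityMeasure W := by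
    constructor
    have := congrArg (fun μ => μ univ) hW1
    simpa [Measure.map_apply measurable_fst MeasurableSet.univ] using this
  have hmem : W ∈ distSet ρ P D := by
    refine ⟨hWp, hW1, ?_⟩
    rw [coe_le_iff_ofReal hD, hW, lintegral_withDensity_eq_lintegral_mul _ hw hρm.ennreal_ofReal,
      lintegral_prod _ (hw.mul hρm.ennreal_ofReal).aemeasurable]
    simpa [mul_comm] using hd
  refine (iInf₂_le W hmem).trans ?_
  rw [relEnt_eq_klDiv, klDiv_eq_lintegral_klFun_of_ac (withDensity_absolutelyContinuous _ _),
    ← lintegral_prod (fun z => ENNReal.ofReal (klFun (w z).toReal)) (by fun_prop)]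
  refine le_of_eq (lintegral_congr_ae ?_)
  filter_upwards [Measure.rnDeriv_withDensity (P.prod Q) hw] with z hz
  rw [hz]

open InformationTheory in
lemma exists_density {ρ : S × T → ℝ} (hρm : Measurable ρ)
    (P : Measure S) (Q : Measure T) [IsProbabilityMeasure P] [IsProbabilityMeasure Q]
    {D : ℝ} (hD : 0 ≤ D) {W : Measure (S × T)} (hW : W ∈ distSet ρ P D)
    (hfin : relEnt W (P.prod Q) ≠ ∞) :
    ∃ w : S × T → ℝ≥0∞, Measurable w ∧ (∀ᵐ x ∂P, ∫⁻ y, w (x, y) ∂Q = 1) ∧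
      ∫⁻ x, ∫⁻ y, ENNReal.ofReal (ρ (x, y)) * w (x, y) ∂Q ∂P ≤ ENNReal.ofReal D ∧
      ∫⁻ x, ∫⁻ y, ENNReal.ofReal (klFun (w (x, y)).toReal) ∂Q ∂P = relEnt W (P.prod Q) := by
  obtain ⟨hWp, hW1, hWD⟩ := hW
  have hac : W ≪ P.prod Q := by
    by_contra h
    exact hfin (by simp [relEnt, h])
  set w := W.rnDeriv (P.prod Q) with hw
  have hwm : Measurable w := Measure.measurable_rnDeriv _ _
  have hWw : (P.prod Q).withDensity w = W := Measure.withDensity_rnDeriv_eq _ _ hac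
  refine ⟨w, hwm, ?_, ?_, ?_⟩
  · have : (fun x => ∫⁻ y, w (x, y) ∂Q) =ᵐ[P] fun _ => 1 := by
      refine ae_eq_of_forall_setLIntegral_eq_of_sigmaFinite hwm.lintegral_prod_right' measurable_const ?_
      intro A hA _
      have e : (Prod.fst ⁻¹' A : Set (S × T)) = A ×ˢ univ := by ext; simp
      have h1 : W (Prod.fst ⁻¹' A) = P A := by
        rw [← Measure.map_apply measurable_fst hA, hW1]
      rw [← hWw, withDensity_apply _ (measurable_fst hA), e, ← Measure.prod_restrict,
        lintegral_prod _ hwm.aemeasurable, Measure.restrict_univ] at h1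
      rw [h1]; simp
    exact this
  · rw [coe_le_iff_ofReal hD, ← hWw, lintegral_withDensity_eq_lintegral_mul _ hwm hρm.ennreal_ofReal,
      lintegral_prod _ (hwm.mul hρm.ennreal_ofReal).aemeasurable] at hWD
    simpa [mul_comm] using hWD
  · rw [relEnt_eq_klDiv, klDiv_eq_lintegral_klFun_of_ac hac,
      ← lintegral_prod (fun z => ENNReal.ofReal (klFun (w z).toReal)) (by fun_prop)]

/-- The partition function. -/
def zPart (ρ : S × T → ℝ) (Q : Measure T) (l : ℝ) (x : S) : ℝ≥0∞ :=
  ∫⁻ y, ENNReal.ofReal (Real.exp (-(l * ρ (x, y)))) ∂Q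

/-- Minus the log partition function. -/
def phiF (ρ : S × T → ℝ) (Q : Measure T) (l : ℝ) (x : S) : ℝ :=
  -Real.log (zPart ρ Q l x).toReal

/-- The tilted density. -/
def tiltW (ρ : S × T → ℝ) (Q : Measure T) (l : ℝ) (z : S × T) : ℝ≥0∞ :=
  ENNReal.ofReal (Real.exp (phiF ρ Q l z.1 - l * ρ z))


lemma zPart_measurable {ρ : S × T → ℝ} (hρm : Measurable ρ)
    (Q : Measure T) [IsProbabilityMeasure Q] (l : ℝ) : Measurable (zPart ρ Q l) := by
  unfold zPart
  exact Measurable.lintegral_prod_right' (f := fun z : S × T => ENNReal.ofReal (Real.exp (-(l * ρ z))))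
    (by fun_prop)

lemma phiF_measurable {ρ : S × T → ℝ} (hρm : Measurable ρ)
    (Q : Measure T) [IsProbabilityMeasure Q] (l : ℝ) : Measurable (phiF ρ Q l) :=
  (Real.measurable_log.comp (zPart_measurable hρm Q l).ennreal_toReal).neg

lemma tiltW_measurable {ρ : S × T → ℝ} (hρm : Measurable ρ)
    (Q : Measure T) [IsProbabilityMeasure Q] (l : ℝ) : Measurable (tiltW ρ Q l) := by
  have := phiF_measurable hρm Q l
  unfold tiltW
  fun_prop

lemma zPart_ne_zero {ρ : S × T → ℝ} (hρm : Measurable ρ)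
    (Q : Measure T) [IsProbabilityMeasure Q] (l : ℝ) (x : S) : zPart ρ Q l x ≠ 0 := by
  intro h
  rw [zPart, lintegral_eq_zero_iff (by fun_prop)] at h
  obtain ⟨y, hy⟩ := h.exists
  simp at hy
  exact absurd hy (not_le.2 (Real.exp_pos _))

lemma zPart_le_one {ρ : S × T → ℝ} (hρm : Measurable ρ) (hρ0 : ∀ z, 0 ≤ ρ z)
    (Q : Measure T) [IsProbabilityMeasure Q] {l : ℝ} (hl : 0 ≤ l) (x : S) : zPart ρ Q l x ≤ 1 := by
  calc zPart ρ Q l x ≤ ∫⁻ y, 1 ∂Q := by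
        refine lintegral_mono fun y => ?_
        rw [ENNReal.ofReal_le_one, Real.exp_le_one_iff]
        have := mul_nonneg hl (hρ0 (x, y))
        linarith
    _ = 1 := by simp

lemma zPart_toReal_pos {ρ : S × T → ℝ} (hρm : Measurable ρ) (hρ0 : ∀ z, 0 ≤ ρ z)
    (Q : Measure T) [IsProbabilityMeasure Q] {l : ℝ} (hl : 0 ≤ l) (x : S) : 0 < (zPart ρ Q l x).toReal :=
  ENNReal.toReal_pos (zPart_ne_zero hρm Q l x)
    ((zPart_le_one hρm hρ0 Q hl x).trans_lt ENNReal.one_lt_top).ne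

lemma zPart_toReal_le_one {ρ : S × T → ℝ} (hρm : Measurable ρ) (hρ0 : ∀ z, 0 ≤ ρ z)
    (Q : Measure T) [IsProbabilityMeasure Q] {l : ℝ} (hl : 0 ≤ l) (x : S) : (zPart ρ Q l x).toReal ≤ 1 :=
  ENNReal.toReal_le_of_le_ofReal zero_le_one (by simpa using zPart_le_one hρm hρ0 Q hl x)

lemma phiF_nonneg {ρ : S × T → ℝ} (hρm : Measurable ρ) (hρ0 : ∀ z, 0 ≤ ρ z)
    (Q : Measure T) [IsProbabilityMeasure Q] {l : ℝ} (hl : 0 ≤ l) (x : S) : 0 ≤ phiF ρ Q l x := by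
  have := Real.log_nonpos (zPart_toReal_pos hρm hρ0 Q hl x).le (zPart_toReal_le_one hρm hρ0 Q hl x)
  unfold phiF; linarith

lemma phiF_mono {ρ : S × T → ℝ} (hρm : Measurable ρ) (hρ0 : ∀ z, 0 ≤ ρ z)
    (Q : Measure T) [IsProbabilityMeasure Q] {l l' : ℝ} (hl : 0 ≤ l) (hll : l ≤ l') (x : S) : phiF ρ Q l x ≤ phiF ρ Q l' x := by
  unfold phiF
  rw [neg_le_neg_iff]
  refine Real.log_le_log (zPart_toReal_pos hρm hρ0 Q (hl.trans hll) x) (ENNReal.toReal_mono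
    ((zPart_le_one hρm hρ0 Q hl x).trans_lt ENNReal.one_lt_top).ne ?_)
  refine lintegral_mono fun y => ENNReal.ofReal_le_ofReal (Real.exp_le_exp.2 ?_)
  have := mul_le_mul_of_nonneg_right hll (hρ0 (x, y))
  linarith

lemma lintegral_tiltW {ρ : S × T → ℝ} (hρm : Measurable ρ) (hρ0 : ∀ z, 0 ≤ ρ z)
    (Q : Measure T) [IsProbabilityMeasure Q] {l : ℝ} (hl : 0 ≤ l) (x : S) : ∫⁻ y, tiltW ρ Q l (x, y) ∂Q = 1 := by
  have hp := zPart_toReal_pos hρm hρ0 Q hl x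
  have hne := ((zPart_le_one hρm hρ0 Q hl x).trans_lt ENNReal.one_lt_top).ne
  have : ∀ y, tiltW ρ Q l (x, y) =
      ENNReal.ofReal (Real.exp (phiF ρ Q l x)) * ENNReal.ofReal (Real.exp (-(l * ρ (x, y)))) := by
    intro y
    rw [tiltW, ← ENNReal.ofReal_mul (Real.exp_pos _).le, ← Real.exp_add, sub_eq_add_neg]
  simp_rw [this]
  rw [lintegral_const_mul _ (by fun_prop)]
  change _ * zPart ρ Q l x = 1
  rw [phiF, Real.exp_neg, Real.exp_log hp, ENNReal.ofReal_inv_of_pos hp, ENNReal.ofReal_toReal hne,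
    ENNReal.inv_mul_cancel (zPart_ne_zero hρm Q l x) hne]

lemma young_aux {a u : ℝ} (ha : 0 ≤ a) :
    u * a + 1 ≤ InformationTheory.klFun a + Real.exp u := by
  rw [InformationTheory.klFun_apply]
  rcases ha.eq_or_lt with rfl | ha
  · simp; exact (Real.exp_pos u).le
  · have h1 := Real.add_one_le_exp (u - Real.log a)
    rw [Real.exp_sub, Real.exp_log ha, le_div_iff₀ ha] at h1
    nlinarith

open InformationTheory in
/-- Pointwise duality inequality. -/
lemma phiF_le {ρ : S × T → ℝ} (hρm : Measurable ρ) (hρ0 : ∀ z, 0 ≤ ρ z)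
    (Q : Measure T) [IsProbabilityMeasure Q] {l : ℝ} (hl : 0 ≤ l) (x : S) {w : S × T → ℝ≥0∞} (hw : Measurable w)
    (hm : ∫⁻ y, w (x, y) ∂Q = 1) :
    ENNReal.ofReal (phiF ρ Q l x) ≤ ∫⁻ y, ENNReal.ofReal (klFun (w (x, y)).toReal) ∂Q +
      ENNReal.ofReal l * ∫⁻ y, ENNReal.ofReal (ρ (x, y)) * w (x, y) ∂Q := by
  have hw' : Measurable fun y => w (x, y) := hw.comp measurable_prodMk_left
  have hρ' : Measurable fun y => ρ (x, y) := hρm.comp measurable_prodMk_left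
  have ht' : Measurable fun y => tiltW ρ Q l (x, y) :=
    (tiltW_measurable hρm Q l).comp measurable_prodMk_left
  have hfin : ∀ᵐ y ∂Q, w (x, y) < ∞ := ae_lt_top hw' (by simp [hm])
  have key : ∫⁻ y, (ENNReal.ofReal (phiF ρ Q l x) * w (x, y) + 1) ∂Q ≤
      ∫⁻ y, (ENNReal.ofReal (klFun (w (x, y)).toReal) +
        ENNReal.ofReal l * (ENNReal.ofReal (ρ (x, y)) * w (x, y)) + tiltW ρ Q l (x, y)) ∂Q := by
    refine lintegral_mono_ae ?_
    filter_upwards [hfin] with y hy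
    set a := (w (x, y)).toReal with ha
    have ha0 : 0 ≤ a := ENNReal.toReal_nonneg
    have hwa : w (x, y) = ENNReal.ofReal a := (ENNReal.ofReal_toReal hy.ne).symm
    have hφ := phiF_nonneg hρm hρ0 Q hl x
    have hk := klFun_nonneg ha0
    have h0 := hρ0 (x, y)
    rw [hwa, tiltW, ← ENNReal.ofReal_mul hφ, ← ENNReal.ofReal_mul h0, ← ENNReal.ofReal_mul hl,
      ← ENNReal.ofReal_one, ← ENNReal.ofReal_add (by positivity) zero_le_one,
      ← ENNReal.ofReal_add hk (by positivity), ← ENNReal.ofReal_add (by positivity) (by positivity)]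
    refine ENNReal.ofReal_le_ofReal ?_
    have := young_aux (u := phiF ρ Q l x - l * ρ (x, y)) ha0
    dsimp only
    nlinarith
  rw [lintegral_add_right _ measurable_const, lintegral_add_right _ ht', lintegral_tiltW hρm hρ0 Q hl,
    lintegral_const_mul _ hw', hm, lintegral_add_right _ (by fun_prop),
    lintegral_const_mul _ (by fun_prop)] at key
  simpa using key

open InformationTheory in
lemma phiF_eq {ρ : S × T → ℝ} (hρm : Measurable ρ) (hρ0 : ∀ z, 0 ≤ ρ z)
    (Q : Measure T) [IsProbabilityMeasure Q] {l : ℝ} (hl : 0 ≤ l) (x : S) :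
    ENNReal.ofReal (phiF ρ Q l x) = ∫⁻ y, ENNReal.ofReal (klFun (tiltW ρ Q l (x, y)).toReal) ∂Q +
      ENNReal.ofReal l * ∫⁻ y, ENNReal.ofReal (ρ (x, y)) * tiltW ρ Q l (x, y) ∂Q := by
  have hρ' : Measurable fun y => ρ (x, y) := hρm.comp measurable_prodMk_left
  have ht' : Measurable fun y => tiltW ρ Q l (x, y) :=
    (tiltW_measurable hρm Q l).comp measurable_prodMk_left
  have key : ∫⁻ y, (ENNReal.ofReal (phiF ρ Q l x) * tiltW ρ Q l (x, y) + 1) ∂Q =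
      ∫⁻ y, (ENNReal.ofReal (klFun (tiltW ρ Q l (x, y)).toReal) +
        ENNReal.ofReal l * (ENNReal.ofReal (ρ (x, y)) * tiltW ρ Q l (x, y)) + tiltW ρ Q l (x, y)) ∂Q := by
    refine lintegral_congr fun y => ?_
    have hφ := phiF_nonneg hρm hρ0 Q hl x
    have h0 := hρ0 (x, y)
    rw [tiltW]
    set a := Real.exp (phiF ρ Q l x - l * ρ (x, y)) with ha
    have ha0 : 0 < a := Real.exp_pos _
    have hk := klFun_nonneg ha0.le
    rw [ENNReal.toReal_ofReal ha0.le, ← ENNReal.ofReal_mul hφ, ← ENNReal.ofReal_mul h0, ← ENNReal.ofReal_mul hl,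
      ← ENNReal.ofReal_one, ← ENNReal.ofReal_add (by positivity) zero_le_one,
      ← ENNReal.ofReal_add hk (by positivity), ← ENNReal.ofReal_add (by positivity) (by positivity)]
    congr 1
    rw [klFun_apply, ha, Real.log_exp]
    ring
  rw [lintegral_add_right _ measurable_const, lintegral_add_right _ ht', lintegral_tiltW hρm hρ0 Q hl,
    lintegral_const_mul _ ht', lintegral_tiltW hρm hρ0 Q hl, lintegral_add_right _ (by fun_prop),
    lintegral_const_mul _ (by fun_prop)] at key
  simpa using key

/-- Easy half of the duality. -/
lemma lintegral_phiF_le {ρ : S × T → ℝ} (hρm : Measurable ρ) (hρ0 : ∀ z, 0 ≤ ρ z)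
    (Q : Measure T) [IsProbabilityMeasure Q] (P : Measure S) [IsProbabilityMeasure P] {D : ℝ} (hD : 0 ≤ D)
    {l : ℝ} (hl : 0 ≤ l) :
    ∫⁻ x, ENNReal.ofReal (phiF ρ Q l x) ∂P ≤ Rrate ρ P Q D + ENNReal.ofReal l * ENNReal.ofReal D := by
  rw [← tsub_le_iff_right]
  refine le_iInf₂ fun W hW => ?_
  rw [tsub_le_iff_right]
  by_cases hfin : relEnt W (P.prod Q) = ∞
  · simp [hfin]
  obtain ⟨w, hw, hm, hd, hk⟩ := exists_density hρm P Q hD hW hfin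
  rw [← hk]
  calc ∫⁻ x, ENNReal.ofReal (phiF ρ Q l x) ∂P
      ≤ ∫⁻ x, (∫⁻ y, ENNReal.ofReal (InformationTheory.klFun (w (x, y)).toReal) ∂Q +
        ENNReal.ofReal l * ∫⁻ y, ENNReal.ofReal (ρ (x, y)) * w (x, y) ∂Q) ∂P := by
        refine lintegral_mono_ae ?_
        filter_upwards [hm] with x hx
        exact phiF_le hρm hρ0 Q hl x hw hx
    _ = _ := by
        rw [lintegral_add_left, lintegral_const_mul]
        · exact Measurable.lintegral_prod_right' (f := fun z => ENNReal.ofReal (ρ z) * w z) (by fun_prop)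
        · exact Measurable.lintegral_prod_right' (f := fun z => ENNReal.ofReal (InformationTheory.klFun (w z).toReal)) (by fun_prop)
    _ ≤ _ := by gcongr



/-- Expected distortion under the tilted density. -/
def mTilt (ρ : S × T → ℝ) (Q : Measure T) (l : ℝ) (x : S) : ℝ≥0∞ :=
  ∫⁻ y, ENNReal.ofReal (ρ (x, y)) * tiltW ρ Q l (x, y) ∂Q

lemma mTilt_measurable {ρ : S × T → ℝ} (hρm : Measurable ρ)
    (Q : Measure T) [IsProbabilityMeasure Q] (l : ℝ) : Measurable (mTilt ρ Q l) := by
  have := tiltW_measurable hρm Q l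
  exact Measurable.lintegral_prod_right' (f := fun z => ENNReal.ofReal (ρ z) * tiltW ρ Q l z)
    (by fun_prop)

lemma zPart_continuousOn {ρ : S × T → ℝ} (hρm : Measurable ρ) (hρ0 : ∀ z, 0 ≤ ρ z)
    (Q : Measure T) [IsProbabilityMeasure Q] (x : S) : ContinuousOn (fun l => zPart ρ Q l x) (Ici 0) := by
  intro l0 hl0
  refine tendsto_lintegral_filter_of_dominated_convergence (fun _ => 1) ?_ ?_ (by simp) ?_
  · exact Eventually.of_forall fun l => by fun_prop
  · filter_upwards [self_mem_nhdsWithin] with l hl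
    refine Eventually.of_forall fun y => ?_
    rw [ENNReal.ofReal_le_one, Real.exp_le_one_iff]
    have := mul_nonneg (mem_Ici.1 hl) (hρ0 (x, y))
    linarith
  · refine Eventually.of_forall fun y => ?_
    have : Continuous fun l : ℝ => ENNReal.ofReal (Real.exp (-(l * ρ (x, y)))) :=
      ENNReal.continuous_ofReal.comp (by fun_prop)
    exact (this.tendsto l0).mono_left nhdsWithin_le_nhds

lemma phiF_continuousOn {ρ : S × T → ℝ} (hρm : Measurable ρ) (hρ0 : ∀ z, 0 ≤ ρ z)
    (Q : Measure T) [IsProbabilityMeasure Q] (x : S) : ContinuousOn (fun l => phiF ρ Q l x) (Ici 0) := by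
  intro l0 hl0
  have h1 := zPart_continuousOn hρm hρ0 Q x l0 hl0
  have hne := ((zPart_le_one hρm hρ0 Q (mem_Ici.1 hl0) x).trans_lt ENNReal.one_lt_top).ne
  have h2 := (ENNReal.tendsto_toReal hne).comp h1
  exact (h2.log (zPart_toReal_pos hρm hρ0 Q (mem_Ici.1 hl0) x).ne').neg

lemma mul_exp_neg_le {a t : ℝ} (ha : 0 < a) : t * Real.exp (-(a * t)) ≤ 1 / a := by
  rw [Real.exp_neg, ← div_eq_mul_inv, div_le_div_iff₀ (Real.exp_pos _) ha]
  have := Real.add_one_le_exp (a * t)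
  linarith

lemma mTilt_continuousAt {ρ : S × T → ℝ} (hρm : Measurable ρ) (hρ0 : ∀ z, 0 ≤ ρ z)
    (Q : Measure T) [IsProbabilityMeasure Q] (x : S) {l0 : ℝ} (hl0 : 0 < l0) :
    ContinuousAt (fun l => mTilt ρ Q l x) l0 := by
  have hnb : Icc (l0 / 2) (2 * l0) ∈ 𝓝 l0 := Icc_mem_nhds (by linarith) (by linarith)
  refine tendsto_lintegral_filter_of_dominated_convergence
    (fun _ => ENNReal.ofReal (Real.exp (phiF ρ Q (2 * l0) x) * (1 / (l0 / 2)))) ?_ ?_ (by simp) ?_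
  · refine Eventually.of_forall fun l => ?_
    have := (tiltW_measurable hρm Q l).comp (measurable_prodMk_left (x := x))
    exact (hρm.comp (measurable_prodMk_left (x := x))).ennreal_ofReal.mul this
  · filter_upwards [hnb] with l hl
    refine Eventually.of_forall fun y => ?_
    rw [tiltW, ← ENNReal.ofReal_mul (hρ0 _)]
    refine ENNReal.ofReal_le_ofReal ?_
    have h1 := phiF_mono hρm hρ0 Q (by linarith [hl.1]) hl.2 x
    have h2 := mul_le_mul_of_nonneg_right hl.1 (hρ0 (x, y))
    have h3 : Real.exp (phiF ρ Q l x - l * ρ (x, y)) ≤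
        Real.exp (phiF ρ Q (2 * l0) x) * Real.exp (-(l0 / 2 * ρ (x, y))) := by
      rw [← Real.exp_add]; exact Real.exp_le_exp.2 (by linarith)
    have h4 := mul_exp_neg_le (a := l0 / 2) (t := ρ (x, y)) (by linarith)
    calc ρ (x, y) * Real.exp (phiF ρ Q l x - l * ρ (x, y))
        ≤ ρ (x, y) * (Real.exp (phiF ρ Q (2 * l0) x) * Real.exp (-(l0 / 2 * ρ (x, y)))) :=
          mul_le_mul_of_nonneg_left h3 (hρ0 _)
      _ = Real.exp (phiF ρ Q (2 * l0) x) * (ρ (x, y) * Real.exp (-(l0 / 2 * ρ (x, y)))) := by ring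
      _ ≤ _ := mul_le_mul_of_nonneg_left h4 (Real.exp_pos _).le
  · refine Eventually.of_forall fun y => ?_
    have h1 : ContinuousAt (fun l => phiF ρ Q l x) l0 :=
      (phiF_continuousOn hρm hρ0 Q x).continuousAt (Ici_mem_nhds hl0)
    have h2 : ContinuousAt (fun l => Real.exp (phiF ρ Q l x - l * ρ (x, y))) l0 := by fun_prop
    exact ENNReal.Tendsto.const_mul (ENNReal.tendsto_ofReal h2) (Or.inr ENNReal.ofReal_ne_top)

lemma mul_mTilt_le {ρ : S × T → ℝ} (hρm : Measurable ρ) (hρ0 : ∀ z, 0 ≤ ρ z)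
    (Q : Measure T) [IsProbabilityMeasure Q] {l : ℝ} (hl : 0 ≤ l) (x : S) :
    ENNReal.ofReal l * mTilt ρ Q l x ≤ ENNReal.ofReal (phiF ρ Q l x) := by
  rw [phiF_eq hρm hρ0 Q hl x]
  exact le_add_self

lemma dTilt_continuousAt {ρ : S × T → ℝ} (hρm : Measurable ρ) (hρ0 : ∀ z, 0 ≤ ρ z)
    (Q : Measure T) [IsProbabilityMeasure Q] (P : Measure S) {l0 : ℝ} (hl0 : 0 < l0)
    (hfin : ∀ l, 0 < l → ∫⁻ x, ENNReal.ofReal (phiF ρ Q l x) ∂P ≠ ∞) :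
    ContinuousAt (fun l => ∫⁻ x, mTilt ρ Q l x ∂P) l0 := by
  have hnb : Icc (l0 / 2) (2 * l0) ∈ 𝓝 l0 := Icc_mem_nhds (by linarith) (by linarith)
  have hpos : ENNReal.ofReal (l0 / 2) ≠ 0 := by simp [hl0]
  refine tendsto_lintegral_filter_of_dominated_convergence
    (fun x => (ENNReal.ofReal (l0 / 2))⁻¹ * ENNReal.ofReal (phiF ρ Q (2 * l0) x)) ?_ ?_ ?_ ?_
  · exact Eventually.of_forall fun l => mTilt_measurable hρm Q l
  · filter_upwards [hnb] with l hl
    refine Eventually.of_forall fun x => ?_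
    have hl0' : 0 ≤ l := by linarith [hl.1]
    rw [← ENNReal.mul_le_iff_le_inv hpos ENNReal.ofReal_ne_top]
    calc ENNReal.ofReal (l0 / 2) * mTilt ρ Q l x ≤ ENNReal.ofReal l * mTilt ρ Q l x := by
          gcongr; exact hl.1
      _ ≤ ENNReal.ofReal (phiF ρ Q l x) := mul_mTilt_le hρm hρ0 Q hl0' x
      _ ≤ _ := ENNReal.ofReal_le_ofReal (phiF_mono hρm hρ0 Q hl0' hl.2 x)
  · rw [lintegral_const_mul _ (phiF_measurable hρm Q _).ennreal_ofReal]
    exact ENNReal.mul_ne_top (ENNReal.inv_ne_top.2 hpos) (hfin _ (by linarith))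
  · exact Eventually.of_forall fun x => mTilt_continuousAt hρm hρ0 Q x hl0

open InformationTheory in
lemma tilt_identity {ρ : S × T → ℝ} (hρm : Measurable ρ) (hρ0 : ∀ z, 0 ≤ ρ z)
    (Q : Measure T) [IsProbabilityMeasure Q] (P : Measure S) {l : ℝ} (hl : 0 ≤ l) :
    ∫⁻ x, ENNReal.ofReal (phiF ρ Q l x) ∂P =
      ∫⁻ x, ∫⁻ y, ENNReal.ofReal (klFun (tiltW ρ Q l (x, y)).toReal) ∂Q ∂P +
      ENNReal.ofReal l * ∫⁻ x, mTilt ρ Q l x ∂P := by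
  rw [lintegral_congr (phiF_eq hρm hρ0 Q hl), lintegral_add_right, lintegral_const_mul]
  · rfl
  · exact mTilt_measurable hρm Q l
  · exact (mTilt_measurable hρm Q l).const_mul _

open InformationTheory in
lemma Rrate_le_tilt {ρ : S × T → ℝ} (hρm : Measurable ρ) (hρ0 : ∀ z, 0 ≤ ρ z)
    (Q : Measure T) [IsProbabilityMeasure Q] (P : Measure S) [IsProbabilityMeasure P] {D : ℝ} (hD : 0 ≤ D) {l : ℝ} (hl : 0 ≤ l)
    (hd : ∫⁻ x, mTilt ρ Q l x ∂P ≤ ENNReal.ofReal D) :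
    Rrate ρ P Q D ≤ ∫⁻ x, ∫⁻ y, ENNReal.ofReal (klFun (tiltW ρ Q l (x, y)).toReal) ∂Q ∂P :=
  Rrate_le_of_density hρm P Q hD (tiltW_measurable hρm Q l)
    (Eventually.of_forall fun x => lintegral_tiltW hρm hρ0 Q hl x) hd

lemma dual_case_a {ρ : S × T → ℝ} (hρm : Measurable ρ) (hρ0 : ∀ z, 0 ≤ ρ z)
    (Q : Measure T) [IsProbabilityMeasure Q] (P : Measure S) [IsProbabilityMeasure P] {D : ℝ} (hD : 0 ≤ D) {l : ℝ} (hl : 0 ≤ l)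
    {L : ℝ≥0∞} (hG : ∫⁻ x, ENNReal.ofReal (phiF ρ Q l x) ∂P ≤ L + ENNReal.ofReal l * ENNReal.ofReal D)
    (hd : ∫⁻ x, mTilt ρ Q l x ∂P = ENNReal.ofReal D) :
    Rrate ρ P Q D ≤ L := by
  refine (Rrate_le_tilt hρm hρ0 Q P hD hl hd.le).trans ?_
  rw [tilt_identity hρm hρ0 Q P hl, hd] at hG
  exact (ENNReal.add_le_add_iff_right (ENNReal.mul_ne_top ENNReal.ofReal_ne_top ENNReal.ofReal_ne_top)).1 hG

lemma dual_case_b {ρ : S × T → ℝ} (hρm : Measurable ρ) (hρ0 : ∀ z, 0 ≤ ρ z)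
    (Q : Measure T) [IsProbabilityMeasure Q] (P : Measure S) [IsProbabilityMeasure P] {D : ℝ} (hD : 0 ≤ D)
    (hfin : ∀ l, 0 < l → ∫⁻ x, ENNReal.ofReal (phiF ρ Q l x) ∂P ≠ ∞)
    (hd : ∀ l, 0 < l → ∫⁻ x, mTilt ρ Q l x ∂P ≤ ENNReal.ofReal D) :
    Rrate ρ P Q D = 0 := by
  have h1 : ∀ l, 0 < l → Rrate ρ P Q D ≤ ∫⁻ x, ENNReal.ofReal (phiF ρ Q l x) ∂P := by
    intro l hl
    refine (Rrate_le_tilt hρm hρ0 Q P hD hl.le (hd l hl)).trans ?_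
    rw [tilt_identity hρm hρ0 Q P hl.le]
    exact le_self_add
  have h2 : Tendsto (fun l => ∫⁻ x, ENNReal.ofReal (phiF ρ Q l x) ∂P) (𝓝[>] 0) (𝓝 (∫⁻ x, 0 ∂P)) := by
    refine tendsto_lintegral_filter_of_dominated_convergence
      (fun x => ENNReal.ofReal (phiF ρ Q 1 x)) ?_ ?_ (hfin 1 one_pos) ?_
    · exact Eventually.of_forall fun l => (phiF_measurable hρm Q l).ennreal_ofReal
    · filter_upwards [Ioo_mem_nhdsGT one_pos] with l hl
      exact Eventually.of_forall fun x =>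
        ENNReal.ofReal_le_ofReal (phiF_mono hρm hρ0 Q hl.1.le hl.2.le x)
    · refine Eventually.of_forall fun x => ?_
      have h3 := phiF_continuousOn hρm hρ0 Q x 0 self_mem_Ici
      have h4 : phiF ρ Q 0 x = 0 := by simp [phiF, zPart]
      have h5 : Tendsto (fun l => phiF ρ Q l x) (𝓝[>] 0) (𝓝 (phiF ρ Q 0 x)) :=
        h3.mono_left (nhdsWithin_mono _ Ioi_subset_Ici_self)
      rw [h4] at h5
      simpa using ENNReal.tendsto_ofReal h5
  rw [lintegral_zero] at h2
  refine le_antisymm (ge_of_tendsto h2 ?_) (zero_le)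
  filter_upwards [self_mem_nhdsWithin] with l hl
  exact h1 l hl

/-- Essential infimum of the distortion. -/
def rInf (ρ : S × T → ℝ) (Q : Measure T) (x : S) : ℝ :=
  (essInf (fun y => ENNReal.ofReal (ρ (x, y))) Q).toReal

lemma rInf_ofReal {ρ : S × T → ℝ}
    (Q : Measure T) [IsProbabilityMeasure Q] (x : S) :
    ENNReal.ofReal (rInf ρ Q x) = essInf (fun y => ENNReal.ofReal (ρ (x, y))) Q := by
  refine ENNReal.ofReal_toReal ?_
  obtain ⟨y, hy⟩ := (ae_essInf_le (μ := Q) (f := fun y => ENNReal.ofReal (ρ (x, y)))).exists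
  exact (hy.trans_lt ENNReal.ofReal_lt_top).ne

lemma rInf_nonneg {ρ : S × T → ℝ}
    (Q : Measure T) [IsProbabilityMeasure Q] (x : S) : 0 ≤ rInf ρ Q x := ENNReal.toReal_nonneg

lemma rInf_le {ρ : S × T → ℝ} (hρ0 : ∀ z, 0 ≤ ρ z)
    (Q : Measure T) [IsProbabilityMeasure Q] (x : S) : ∀ᵐ y ∂Q, rInf ρ Q x ≤ ρ (x, y) := by
  filter_upwards [ae_essInf_le (μ := Q) (f := fun y => ENNReal.ofReal (ρ (x, y)))] with y hy
  rw [← rInf_ofReal, ENNReal.ofReal_le_ofReal_iff (hρ0 _)] at hy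
  exact hy

lemma rInf_lt {ρ : S × T → ℝ} (hρ0 : ∀ z, 0 ≤ ρ z)
    (Q : Measure T) [IsProbabilityMeasure Q] (x : S) {ε : ℝ} (hε : 0 < ε) : Q {y | ρ (x, y) < rInf ρ Q x + ε} ≠ 0 := by
  intro h
  have h1 : ∀ᵐ y ∂Q, ENNReal.ofReal (rInf ρ Q x + ε) ≤ ENNReal.ofReal (ρ (x, y)) := by
    filter_upwards [measure_eq_zero_iff_ae_notMem.1 h] with y hy
    exact ENNReal.ofReal_le_ofReal (not_lt.1 hy)
  have h2 := le_essInf_of_ae_le _ h1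
  rw [← rInf_ofReal, ENNReal.ofReal_le_ofReal_iff (rInf_nonneg Q x)] at h2
  linarith

lemma mul_rInf_le_phiF {ρ : S × T → ℝ} (hρm : Measurable ρ) (hρ0 : ∀ z, 0 ≤ ρ z)
    (Q : Measure T) [IsProbabilityMeasure Q] {l : ℝ} (hl : 0 ≤ l) (x : S) : l * rInf ρ Q x ≤ phiF ρ Q l x := by
  have h1 : zPart ρ Q l x ≤ ENNReal.ofReal (Real.exp (-(l * rInf ρ Q x))) := by
    calc zPart ρ Q l x ≤ ∫⁻ y, ENNReal.ofReal (Real.exp (-(l * rInf ρ Q x))) ∂Q := by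
          refine lintegral_mono_ae ?_
          filter_upwards [rInf_le hρ0 Q x] with y hy
          refine ENNReal.ofReal_le_ofReal (Real.exp_le_exp.2 ?_)
          have := mul_le_mul_of_nonneg_left hy hl
          linarith
      _ = _ := by simp
  have h2 := ENNReal.toReal_le_of_le_ofReal (Real.exp_pos _).le h1
  have h3 := (Real.log_le_iff_le_exp (zPart_toReal_pos hρm hρ0 Q hl x)).2 h2
  unfold phiF
  linarith

lemma phiF_le_rInf {ρ : S × T → ℝ} (hρm : Measurable ρ) (hρ0 : ∀ z, 0 ≤ ρ z)
    (Q : Measure T) [IsProbabilityMeasure Q] (x : S) {ε : ℝ} (hε : 0 < ε) : ∃ C : ℝ, ∀ l, 0 ≤ l →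
    phiF ρ Q l x ≤ l * (rInf ρ Q x + ε) + C := by
  set A := {y | ρ (x, y) < rInf ρ Q x + ε} with hA
  have hAm : MeasurableSet A :=
    measurableSet_lt (hρm.comp measurable_prodMk_left) measurable_const
  have hq : 0 < (Q A).toReal := ENNReal.toReal_pos (rInf_lt hρ0 Q x hε) (measure_ne_top _ _)
  refine ⟨-Real.log (Q A).toReal, fun l hl => ?_⟩
  have h1 : ENNReal.ofReal (Real.exp (-(l * (rInf ρ Q x + ε)))) * Q A ≤ zPart ρ Q l x := by
    rw [← setLIntegral_const]
    refine (setLIntegral_mono' hAm fun y hy => ?_).trans (setLIntegral_le_lintegral _ _)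
    refine ENNReal.ofReal_le_ofReal (Real.exp_le_exp.2 ?_)
    have hy' : ρ (x, y) < rInf ρ Q x + ε := hy
    have := mul_le_mul_of_nonneg_left hy'.le hl
    linarith
  have h2 := ENNReal.toReal_mono ((zPart_le_one hρm hρ0 Q hl x).trans_lt ENNReal.one_lt_top).ne h1
  rw [ENNReal.toReal_mul, ENNReal.toReal_ofReal (Real.exp_pos _).le] at h2
  have h3 := Real.log_le_log (by positivity) h2
  rw [Real.log_mul (Real.exp_pos _).ne' hq.ne', Real.log_exp] at h3
  unfold phiF
  linarith

lemma phiF_div_tendsto {ρ : S × T → ℝ} (hρm : Measurable ρ) (hρ0 : ∀ z, 0 ≤ ρ z)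
    (Q : Measure T) [IsProbabilityMeasure Q] (x : S) :
    Tendsto (fun n : ℕ => (n : ℝ)⁻¹ * phiF ρ Q n x) atTop (𝓝 (rInf ρ Q x)) := by
  rw [Metric.tendsto_atTop']
  intro ε hε
  obtain ⟨C, hC⟩ := phiF_le_rInf hρm hρ0 Q x (half_pos hε)
  have hlim : Tendsto (fun n : ℕ => (n : ℝ)⁻¹ * C) atTop (𝓝 0) := by
    simpa using (tendsto_inv_atTop_nhds_zero_nat (𝕜 := ℝ)).mul_const C
  obtain ⟨N, hN⟩ := eventually_atTop.1 ((hlim.eventually (gt_mem_nhds (half_pos hε))).and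
    (eventually_gt_atTop 0))
  refine ⟨N, fun n hn => ?_⟩
  obtain ⟨a, b⟩ := hN n hn.le
  have hn' : (0 : ℝ) < n := by exact_mod_cast b
  have h1 := mul_le_mul_of_nonneg_left (hC n hn'.le) (inv_nonneg.2 hn'.le)
  have h2 := mul_le_mul_of_nonneg_left (mul_rInf_le_phiF hρm hρ0 Q hn'.le x) (inv_nonneg.2 hn'.le)
  rw [mul_add, inv_mul_cancel_left₀ hn'.ne'] at h1
  rw [inv_mul_cancel_left₀ hn'.ne'] at h2
  rw [Real.dist_eq, abs_lt]
  constructor <;> linarith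

lemma rInf_measurable {ρ : S × T → ℝ} (hρm : Measurable ρ) (hρ0 : ∀ z, 0 ≤ ρ z)
    (Q : Measure T) [IsProbabilityMeasure Q] : Measurable (rInf ρ Q) :=
  measurable_of_tendsto_metrizable (fun n : ℕ => (phiF_measurable hρm Q n).const_mul ((n : ℝ)⁻¹))
    (tendsto_pi_nhds.2 (phiF_div_tendsto hρm hρ0 Q))

lemma zPart_toReal_eq {ρ : S × T → ℝ} (hρm : Measurable ρ) (hρ0 : ∀ z, 0 ≤ ρ z)
    (Q : Measure T) [IsProbabilityMeasure Q] {l : ℝ} (x : S) :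
    (zPart ρ Q l x).toReal = ∫ y, Real.exp (-(l * ρ (x, y))) ∂Q := by
  rw [integral_eq_lintegral_of_nonneg_ae (Eventually.of_forall fun y => (Real.exp_pos _).le)]
  · rfl
  · have := hρm.comp (measurable_prodMk_left (x := x))
    exact Measurable.aestronglyMeasurable (by fun_prop)

lemma exp_integrable {ρ : S × T → ℝ} (hρm : Measurable ρ) (hρ0 : ∀ z, 0 ≤ ρ z)
    (Q : Measure T) [IsProbabilityMeasure Q] {l : ℝ} (hl : 0 ≤ l) (x : S) :
    Integrable (fun y => Real.exp (-(l * ρ (x, y)))) Q := by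
  refine Integrable.of_bound (C := 1) (Measurable.aestronglyMeasurable (by fun_prop)) ?_
  refine Eventually.of_forall fun y => ?_
  rw [Real.norm_eq_abs, abs_of_pos (Real.exp_pos _), Real.exp_le_one_iff]
  have := mul_nonneg hl (hρ0 (x, y))
  linarith

lemma phiF_nat_le {ρ : S × T → ℝ} (hρm : Measurable ρ) (hρ0 : ∀ z, 0 ≤ ρ z)
    (Q : Measure T) [IsProbabilityMeasure Q] (n : ℕ) (x : S) : phiF ρ Q n x ≤ n * phiF ρ Q 1 x := by
  have h1 : (zPart ρ Q 1 x).toReal ^ n ≤ (zPart ρ Q n x).toReal := by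
    rw [zPart_toReal_eq hρm hρ0, zPart_toReal_eq hρm hρ0]
    have e : ∀ y, Real.exp (-((n : ℝ) * ρ (x, y))) = (Real.exp (-(1 * ρ (x, y)))) ^ n := by
      intro y; rw [← Real.exp_nat_mul]; congr 1; ring
    have hi := exp_integrable hρm hρ0 Q (Nat.cast_nonneg n) x
    simp_rw [e] at hi ⊢
    exact (convexOn_pow n).map_integral_le (by fun_prop) isClosed_Ici
      (Eventually.of_forall fun y => (Real.exp_pos _).le)
      (exp_integrable hρm hρ0 Q zero_le_one x) hi
  have h2 := Real.log_le_log (pow_pos (zPart_toReal_pos hρm hρ0 Q zero_le_one x) n) h1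
  rw [Real.log_pow] at h2
  unfold phiF
  linarith

/-- The excess of the log partition function over its linear part. -/
lemma psi_tendsto {ρ : S × T → ℝ} (hρm : Measurable ρ) (hρ0 : ∀ z, 0 ≤ ρ z)
    (Q : Measure T) [IsProbabilityMeasure Q] (x : S) :
    Tendsto (fun n : ℕ => Real.exp (-(phiF ρ Q n x - n * rInf ρ Q x))) atTop
      (𝓝 (Q {y | ρ (x, y) ≤ rInf ρ Q x}).toReal) := by
  have hAm : MeasurableSet {y | ρ (x, y) ≤ rInf ρ Q x} :=
    measurableSet_le (hρm.comp measurable_prodMk_left) measurable_const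
  have e : ∀ n : ℕ, Real.exp (-(phiF ρ Q n x - n * rInf ρ Q x)) =
      ∫ y, Real.exp (-(n * (ρ (x, y) - rInf ρ Q x))) ∂Q := by
    intro n
    have : ∀ y, Real.exp (-(n * (ρ (x, y) - rInf ρ Q x))) =
      Real.exp (n * rInf ρ Q x) * Real.exp (-(n * ρ (x, y))) := by
      intro y; rw [← Real.exp_add]; congr 1; ring
    simp_rw [this]
    rw [integral_const_mul, ← zPart_toReal_eq hρm hρ0, neg_sub, sub_eq_add_neg, Real.exp_add, phiF, neg_neg,
      Real.exp_log (zPart_toReal_pos hρm hρ0 Q (Nat.cast_nonneg n) x)]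
  simp_rw [e]
  have e2 : (Q {y | ρ (x, y) ≤ rInf ρ Q x}).toReal =
      ∫ y, {y | ρ (x, y) ≤ rInf ρ Q x}.indicator (fun _ => (1 : ℝ)) y ∂Q := by
    rw [integral_indicator hAm]; simp [measureReal_def]
  rw [e2]
  refine tendsto_integral_of_dominated_convergence (fun _ => 1) ?_ (integrable_const _) ?_ ?_
  · exact fun n => Measurable.aestronglyMeasurable (by fun_prop)
  · intro n
    filter_upwards [rInf_le hρ0 Q x] with y hy
    rw [Real.norm_eq_abs, abs_of_pos (Real.exp_pos _), Real.exp_le_one_iff]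
    have := mul_nonneg (Nat.cast_nonneg (α := ℝ) n) (sub_nonneg.2 hy)
    linarith
  · filter_upwards [rInf_le hρ0 Q x] with y hy
    by_cases hyA : ρ (x, y) ≤ rInf ρ Q x
    · rw [indicator_of_mem (show y ∈ {y | ρ (x, y) ≤ rInf ρ Q x} from hyA)]
      have : ρ (x, y) - rInf ρ Q x = 0 := by linarith
      simp [this]
    · rw [indicator_of_notMem (show y ∉ {y | ρ (x, y) ≤ rInf ρ Q x} from hyA)]
      push Not at hyA
      refine Real.tendsto_exp_neg_atTop_nhds_zero.comp ?_
      exact tendsto_natCast_atTop_atTop.atTop_mul_const (sub_pos.2 hyA)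

lemma psi_liminf {ρ : S × T → ℝ} (hρm : Measurable ρ) (hρ0 : ∀ z, 0 ≤ ρ z)
    (Q : Measure T) [IsProbabilityMeasure Q] (x : S)
    (hfin : liminf (fun n : ℕ => ENNReal.ofReal (phiF ρ Q n x - n * rInf ρ Q x)) atTop ≠ ∞) :
    Q {y | ρ (x, y) ≤ rInf ρ Q x} ≠ 0 ∧
    liminf (fun n : ℕ => ENNReal.ofReal (phiF ρ Q n x - n * rInf ρ Q x)) atTop =
      ENNReal.ofReal (-Real.log (Q {y | ρ (x, y) ≤ rInf ρ Q x}).toReal) := by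
  have ht := psi_tendsto hρm hρ0 Q x
  have e : ∀ n : ℕ, phiF ρ Q n x - n * rInf ρ Q x =
      -Real.log (Real.exp (-(phiF ρ Q n x - n * rInf ρ Q x))) := by
    intro n; rw [Real.log_exp, neg_neg]
  have hne : Q {y | ρ (x, y) ≤ rInf ρ Q x} ≠ 0 := by
    intro h0
    rw [h0, ENNReal.toReal_zero] at ht
    apply hfin
    have h1 : Tendsto (fun n : ℕ => Real.exp (-(phiF ρ Q n x - n * rInf ρ Q x))) atTop (𝓝[>] 0) :=
      tendsto_nhdsWithin_iff.2 ⟨ht, Eventually.of_forall fun n => Real.exp_pos _⟩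
    have h2 := tendsto_neg_atBot_atTop.comp (Real.tendsto_log_nhdsGT_zero.comp h1)
    have h3 : Tendsto (fun n : ℕ => phiF ρ Q n x - n * rInf ρ Q x) atTop atTop := by
      refine h2.congr fun n => ?_
      simp
    exact (ENNReal.tendsto_ofReal_atTop.comp h3).liminf_eq
  refine ⟨hne, ?_⟩
  have hq : (Q {y | ρ (x, y) ≤ rInf ρ Q x}).toReal ≠ 0 :=
    (ENNReal.toReal_pos hne (measure_ne_top _ _)).ne'
  have h3 : Tendsto (fun n : ℕ => phiF ρ Q n x - n * rInf ρ Q x) atTop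
      (𝓝 (-Real.log (Q {y | ρ (x, y) ≤ rInf ρ Q x}).toReal)) :=
    (ht.log hq).neg.congr fun n => by simp
  exact (ENNReal.tendsto_ofReal h3).liminf_eq

open InformationTheory in
lemma dual_case_c {ρ : S × T → ℝ} (hρm : Measurable ρ) (hρ0 : ∀ z, 0 ≤ ρ z)
    (Q : Measure T) [IsProbabilityMeasure Q] (P : Measure S) [IsProbabilityMeasure P] {D : ℝ} (hD : 0 ≤ D)
    {L : ℝ≥0∞} (hL : L ≠ ∞)
    (hG : ∀ l, 0 < l → ∫⁻ x, ENNReal.ofReal (phiF ρ Q l x) ∂P ≤ L + ENNReal.ofReal l * ENNReal.ofReal D)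
    (hd : ∀ l, 0 < l → ENNReal.ofReal D ≤ ∫⁻ x, mTilt ρ Q l x ∂P) :
    Rrate ρ P Q D ≤ L := by
  have hfin : ∀ l, 0 < l → ∫⁻ x, ENNReal.ofReal (phiF ρ Q l x) ∂P ≠ ∞ := fun l hl =>
    ((hG l hl).trans_lt (ENNReal.add_lt_top.2 ⟨hL.lt_top, ENNReal.mul_lt_top ENNReal.ofReal_lt_top
      ENNReal.ofReal_lt_top⟩)).ne
  have hrm := rInf_measurable hρm hρ0 Q
  have hlim : Tendsto (fun n : ℕ => ∫⁻ x, ENNReal.ofReal ((n : ℝ)⁻¹ * phiF ρ Q n x) ∂P) atTop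
      (𝓝 (∫⁻ x, ENNReal.ofReal (rInf ρ Q x) ∂P)) := by
    refine tendsto_lintegral_of_dominated_convergence (fun x => ENNReal.ofReal (phiF ρ Q 1 x)) ?_ ?_
      (hfin 1 one_pos) ?_
    · exact fun n => ((phiF_measurable hρm Q n).const_mul _).ennreal_ofReal
    · intro n
      refine Eventually.of_forall fun x => ENNReal.ofReal_le_ofReal ?_
      rcases Nat.eq_zero_or_pos n with rfl | hn
      · simpa using phiF_nonneg hρm hρ0 Q zero_le_one x
      · have hn' : (0 : ℝ) < n := by exact_mod_cast hn
        rw [inv_mul_le_iff₀ hn']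
        exact phiF_nat_le hρm hρ0 Q n x
    · exact Eventually.of_forall fun x => ENNReal.tendsto_ofReal (phiF_div_tendsto hρm hρ0 Q x)
  have hsplit : ∀ n : ℕ, 0 < n → ∫⁻ x, ENNReal.ofReal ((n : ℝ)⁻¹ * phiF ρ Q n x) ∂P =
      (n : ℝ≥0∞)⁻¹ * ∫⁻ x, ENNReal.ofReal (phiF ρ Q n x) ∂P := by
    intro n hn
    have hn' : (0 : ℝ) < n := by exact_mod_cast hn
    rw [← lintegral_const_mul _ (phiF_measurable hρm Q n).ennreal_ofReal]
    refine lintegral_congr fun x => ?_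
    rw [ENNReal.ofReal_mul (by positivity), ENNReal.ofReal_inv_of_pos hn', ENNReal.ofReal_natCast]
  have hge : ENNReal.ofReal D ≤ ∫⁻ x, ENNReal.ofReal (rInf ρ Q x) ∂P := by
    refine ge_of_tendsto hlim ?_
    filter_upwards [eventually_gt_atTop 0] with n hn
    have hn' : (0 : ℝ) < n := by exact_mod_cast hn
    rw [hsplit n hn, ← ENNReal.mul_le_iff_le_inv (by simp; omega) (by simp)]
    calc (n : ℝ≥0∞) * ENNReal.ofReal D ≤ ENNReal.ofReal n * ∫⁻ x, mTilt ρ Q n x ∂P := by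
          rw [ENNReal.ofReal_natCast]; gcongr; exact hd n hn'
      _ ≤ _ := by rw [tilt_identity hρm hρ0 Q P hn'.le]; exact le_add_self
  have hle : ∫⁻ x, ENNReal.ofReal (rInf ρ Q x) ∂P ≤ ENNReal.ofReal D := by
    have h1 : Tendsto (fun n : ℕ => (n : ℝ≥0∞)⁻¹ * L + ENNReal.ofReal D) atTop (𝓝 (0 * L + ENNReal.ofReal D)) :=
      (ENNReal.Tendsto.mul_const ENNReal.tendsto_inv_nat_nhds_zero (Or.inr hL)).add tendsto_const_nhds
    rw [zero_mul, zero_add] at h1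
    refine le_of_tendsto_of_tendsto hlim h1 ?_
    filter_upwards [eventually_gt_atTop 0] with n hn
    have hn' : (0 : ℝ) < n := by exact_mod_cast hn
    rw [hsplit n hn]
    calc _ ≤ (n : ℝ≥0∞)⁻¹ * (L + ENNReal.ofReal n * ENNReal.ofReal D) := by
          gcongr; exact hG n hn'
      _ = _ := by
          rw [mul_add, ENNReal.ofReal_natCast, ← mul_assoc,
            ENNReal.inv_mul_cancel (by simp; omega) (by simp), one_mul]
  have heq := le_antisymm hle hge
  have hpsi : ∀ n : ℕ, 0 < n → ∫⁻ x, ENNReal.ofReal (phiF ρ Q n x - n * rInf ρ Q x) ∂P ≤ L := by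
    intro n hn
    have hn' : (0 : ℝ) < n := by exact_mod_cast hn
    have h1 : ∫⁻ x, ENNReal.ofReal (phiF ρ Q n x) ∂P =
        ∫⁻ x, ENNReal.ofReal (phiF ρ Q n x - n * rInf ρ Q x) ∂P + ENNReal.ofReal n * ENNReal.ofReal D := by
      rw [← heq, ← lintegral_const_mul _ hrm.ennreal_ofReal, ← lintegral_add_right _ (by fun_prop)]
      refine lintegral_congr fun x => ?_
      rw [← ENNReal.ofReal_mul hn'.le, ← ENNReal.ofReal_add
        (sub_nonneg.2 (mul_rInf_le_phiF hρm hρ0 Q hn'.le x)) (mul_nonneg hn'.le (rInf_nonneg Q x))]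
      congr 1; ring
    have h2 := hG n hn'
    rw [h1] at h2
    exact (ENNReal.add_le_add_iff_right (ENNReal.mul_ne_top ENNReal.ofReal_ne_top ENNReal.ofReal_ne_top)).1 h2
  have hpm : ∀ n : ℕ, Measurable fun x => ENNReal.ofReal (phiF ρ Q n x - n * rInf ρ Q x) := fun n =>
    ((phiF_measurable hρm Q n).sub (hrm.const_mul _)).ennreal_ofReal
  have hfatou : ∫⁻ x, liminf (fun n : ℕ => ENNReal.ofReal (phiF ρ Q n x - n * rInf ρ Q x)) atTop ∂P ≤ L := by
    refine (lintegral_liminf_le hpm).trans ?_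
    refine liminf_le_of_frequently_le' (Eventually.frequently ?_)
    filter_upwards [eventually_gt_atTop 0] with n hn
    exact hpsi n hn
  have hae : ∀ᵐ x ∂P, liminf (fun n : ℕ => ENNReal.ofReal (phiF ρ Q n x - n * rInf ρ Q x)) atTop < ∞ :=
    ae_lt_top (Measurable.liminf hpm) (hfatou.trans_lt hL.lt_top).ne
  set E : Set (S × T) := {z | ρ z ≤ rInf ρ Q z.1} with hE
  have hEm : MeasurableSet E := measurableSet_le hρm (hrm.comp measurable_fst)
  set q : S → ℝ≥0∞ := fun x => Q {y | ρ (x, y) ≤ rInf ρ Q x} with hqdef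
  have hqm : Measurable q := measurable_measure_prodMk_left hEm
  set w : S × T → ℝ≥0∞ := E.indicator (fun z => (q z.1)⁻¹) with hwdef
  have hwm : Measurable w := (hqm.comp measurable_fst).inv.indicator hEm
  have hAm : ∀ x, MeasurableSet {y | ρ (x, y) ≤ rInf ρ Q x} := fun x =>
    measurableSet_le (hρm.comp measurable_prodMk_left) measurable_const
  have hw1 : ∀ x, q x ≠ 0 → ∫⁻ y, w (x, y) ∂Q = 1 := by
    intro x hx
    have : ∀ y, w (x, y) = {y | ρ (x, y) ≤ rInf ρ Q x}.indicator (fun _ => (q x)⁻¹) y := fun y => rfl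
    simp_rw [this]
    rw [lintegral_indicator_const (hAm x)]
    exact ENNReal.inv_mul_cancel hx (measure_ne_top _ _)
  refine (Rrate_le_of_density hρm P Q hD hwm ?_ ?_).trans ?_
  · filter_upwards [hae] with x hx
    exact hw1 x (psi_liminf hρm hρ0 Q x hx.ne).1
  · refine le_trans ?_ hle
    refine lintegral_mono_ae ?_
    filter_upwards [hae] with x hx
    have h1 := hw1 x (psi_liminf hρm hρ0 Q x hx.ne).1
    calc ∫⁻ y, ENNReal.ofReal (ρ (x, y)) * w (x, y) ∂Q
        ≤ ∫⁻ y, ENNReal.ofReal (rInf ρ Q x) * w (x, y) ∂Q := by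
          refine lintegral_mono fun y => ?_
          by_cases hy : (x, y) ∈ E
          · have hy' : ρ (x, y) ≤ rInf ρ Q x := hy
            gcongr
          · simp [hwdef, hy]
      _ = _ := by rw [lintegral_const_mul _ (by fun_prop), h1, mul_one]
  · refine le_trans (lintegral_mono_ae ?_) hfatou
    filter_upwards [hae] with x hx
    obtain ⟨hq0, hq1⟩ := psi_liminf hρm hρ0 Q x hx.ne
    rw [hq1]
    have h1 := hw1 x hq0
    have hqr : 0 < (q x).toReal := ENNReal.toReal_pos hq0 (measure_ne_top _ _)
    have hqle : (q x).toReal ≤ 1 := measureReal_le_one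
    have hlog : 0 ≤ -Real.log (q x).toReal := by
      have := Real.log_nonpos hqr.le hqle
      linarith
    have key : ∫⁻ y, (ENNReal.ofReal (klFun (w (x, y)).toReal) + w (x, y)) ∂Q =
        ∫⁻ y, (ENNReal.ofReal (-Real.log (q x).toReal) * w (x, y) + 1) ∂Q := by
      refine lintegral_congr fun y => ?_
      by_cases hy : (x, y) ∈ E
      · have hw2 : w (x, y) = ENNReal.ofReal ((q x).toReal⁻¹) := by
          rw [hwdef, indicator_of_mem hy, ENNReal.ofReal_inv_of_pos hqr,
            ENNReal.ofReal_toReal (measure_ne_top _ _)]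
        have hinv : 0 ≤ (q x).toReal⁻¹ := by positivity
        rw [hw2, ENNReal.toReal_ofReal hinv, ← ENNReal.ofReal_add (klFun_nonneg hinv) hinv,
          ← ENNReal.ofReal_mul hlog, ← ENNReal.ofReal_one, ← ENNReal.ofReal_add (by positivity) zero_le_one]
        congr 1
        rw [klFun_apply, Real.log_inv]
        ring
      · simp [hwdef, hy, klFun_zero]
    rw [lintegral_add_right _ (by fun_prop), h1, lintegral_add_right _ measurable_const,
      lintegral_const_mul _ (by fun_prop), h1, mul_one] at key
    simp only [lintegral_const, measure_univ, mul_one] at key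
    exact ((ENNReal.add_left_inj ENNReal.one_ne_top).1 key).le

/-- Hard half of the duality. -/
lemma dual_hard {ρ : S × T → ℝ} (hρm : Measurable ρ) (hρ0 : ∀ z, 0 ≤ ρ z)
    (Q : Measure T) [IsProbabilityMeasure Q] (P : Measure S) [IsProbabilityMeasure P] {D : ℝ} (hD : 0 ≤ D)
    {L : ℝ≥0∞} (hL : L ≠ ∞)
    (hG : ∀ l, 0 < l → ∫⁻ x, ENNReal.ofReal (phiF ρ Q l x) ∂P ≤ L + ENNReal.ofReal l * ENNReal.ofReal D) :
    Rrate ρ P Q D ≤ L := by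
  have hfin : ∀ l, 0 < l → ∫⁻ x, ENNReal.ofReal (phiF ρ Q l x) ∂P ≠ ∞ := fun l hl =>
    ((hG l hl).trans_lt (ENNReal.add_lt_top.2 ⟨hL.lt_top, ENNReal.mul_lt_top ENNReal.ofReal_lt_top
      ENNReal.ofReal_lt_top⟩)).ne
  by_cases h1 : ∀ l, 0 < l → ∫⁻ x, mTilt ρ Q l x ∂P ≤ ENNReal.ofReal D
  · rw [dual_case_b hρm hρ0 Q P hD hfin h1]; exact zero_le
  by_cases h2 : ∀ l, 0 < l → ENNReal.ofReal D ≤ ∫⁻ x, mTilt ρ Q l x ∂P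
  · exact dual_case_c hρm hρ0 Q P hD hL hG h2
  push Not at h1 h2
  obtain ⟨a, ha0, ha⟩ := h1
  obtain ⟨b, hb0, hb⟩ := h2
  have hcont : ContinuousOn (fun l => ∫⁻ x, mTilt ρ Q l x ∂P) (uIcc a b) := fun l hl =>
    (dTilt_continuousAt hρm hρ0 Q P ((lt_min ha0 hb0).trans_le hl.1) hfin).continuousWithinAt
  obtain ⟨l, hl, hle⟩ := intermediate_value_uIcc hcont (mem_uIcc.2 (Or.inr ⟨hb.le, ha.le⟩))
  have hl0 : 0 < l := (lt_min ha0 hb0).trans_le hl.1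
  exact dual_case_a hρm hρ0 Q P hD hl0.le (hG l hl0) hle
end ratefn

section final

lemma shift_iter {α : Type*} (k : ℕ) (x : ℕ → α) (n : ℕ) : (shiftSeq^[k] x) n = x (n + k) := by
  induction k generalizing x with
  | zero => rfl
  | succ k ih =>
    rw [Function.iterate_succ_apply, ih]
    simp only [shiftSeq]
    congr 1

lemma birk_emp {S M : Type*} [AddCommMonoid M] (f : S → M) (n : ℕ) (x : ℕ → S) :
    birkhoffSum shiftSeq (fun y : ℕ → S => f (y 0)) n x = ∑ k ∈ Finset.range n, f (x k) := by
  simp [birkhoffSum, shift_iter]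

variable {S : Type*} [MeasurableSpace S]

lemma lintegral_emp {f : S → ℝ≥0∞} (hf : Measurable f) (n : ℕ) (x : ℕ → S) :
    ∫⁻ y, f y ∂(empMeas n x)
      = (n : ℝ≥0∞)⁻¹ * birkhoffSum shiftSeq (fun y : ℕ → S => f (y 0)) n x := by
  rw [birk_emp, empMeas, lintegral_smul_measure, lintegral_finsetSum_measure]
  simp [lintegral_dirac' _ hf]

lemma emp_prob {n : ℕ} (hn : 0 < n) (x : ℕ → S) : IsProbabilityMeasure (empMeas n x) := by
  constructor
  simp only [empMeas, Measure.smul_apply, Measure.finsetSum_apply, measure_univ, smul_eq_mul,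
    Finset.sum_const, Finset.card_range, nsmul_eq_mul, mul_one]
  exact ENNReal.inv_mul_cancel (by simpa using hn.ne') (by simp)

lemma emp_ae {p : S → Prop} (hp : MeasurableSet {s | p s}) (n : ℕ) (x : ℕ → S)
    (h : ∀ k, p (x k)) : ∀ᵐ y ∂(empMeas n x), p y := by
  rw [ae_iff]
  simp only [empMeas, Measure.smul_apply, Measure.finsetSum_apply, smul_eq_mul]
  rw [Finset.sum_eq_zero, mul_zero]
  intro k _
  have e : {a | ¬ p a} = {s | p s}ᶜ := rfl
  rw [e, Measure.dirac_apply' _ hp.compl]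
  simp [h k]

variable {P : Measure S} {Psrc : Measure (ℕ → S)}

lemma src_ae (hErg : Ergodic shiftSeq Psrc) (hP1 : Psrc.map (fun x => x 0) = P)
    {p : S → Prop} (h : ∀ᵐ y ∂P, p y) : ∀ᵐ x ∂Psrc, ∀ k, p (x k) := by
  rw [ae_all_iff]
  intro k
  have h0 : ∀ᵐ x ∂Psrc, p (x 0) :=
    ae_of_ae_map (measurable_pi_apply 0).aemeasurable (hP1 ▸ h)
  have := (hErg.toMeasurePreserving.iterate k).quasiMeasurePreserving.ae h0
  filter_upwards [this] with x hx
  simpa [shift_iter] using hx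

lemma src_lintegral (hP1 : Psrc.map (fun x => x 0) = P) {f : S → ℝ≥0∞} (hf : Measurable f) :
    ∫⁻ x, f (x 0) ∂Psrc = ∫⁻ y, f y ∂P := by
  rw [← hP1, lintegral_map hf (measurable_pi_apply 0)]

variable {T : Type*} [MeasurableSpace T] {ρ : S × T → ℝ}

lemma rate_lower (hρm : Measurable ρ) (hρ0 : ∀ z, 0 ≤ ρ z)
    [IsProbabilityMeasure P] (Q : Measure T) [IsProbabilityMeasure Q]
    [IsProbabilityMeasure Psrc] (hErg : Ergodic shiftSeq Psrc)
    (hP1 : Psrc.map (fun x => x 0) = P) {D : ℝ} (hD : 0 ≤ D) :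
    ∀ᵐ x ∂Psrc, Rrate ρ P Q D ≤ liminf (fun n => Rrate ρ (empMeas n x) Q D) atTop := by
  have h1 : ∀ᵐ x ∂Psrc, ∀ q : ℚ≥0, ∫⁻ y, ENNReal.ofReal (phiF ρ Q (q : ℝ) y) ∂P ≤
      liminf (fun n : ℕ => ∫⁻ y, ENNReal.ofReal (phiF ρ Q (q : ℝ) y) ∂(empMeas n x)) atTop := by
    rw [ae_all_iff]
    intro q
    have hm : Measurable fun y => ENNReal.ofReal (phiF ρ Q (q : ℝ) y) :=
      (phiF_measurable hρm Q _).ennreal_ofReal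
    have := ergodic_lintegral_liminf hErg (hm.comp (measurable_pi_apply 0))
    filter_upwards [this] with x hx
    simp only [lintegral_emp hm]
    rw [← src_lintegral hP1 hm]
    exact hx
  filter_upwards [h1] with x hx
  set L := liminf (fun n => Rrate ρ (empMeas n x) Q D) atTop with hLdef
  by_cases hL : L = ∞
  · rw [hL]; exact le_top
  have hq : ∀ q : ℚ≥0, ∫⁻ y, ENNReal.ofReal (phiF ρ Q (q : ℝ) y) ∂P ≤
      L + ENNReal.ofReal (q : ℝ) * ENNReal.ofReal D := by
    intro q
    refine (hx q).trans ?_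
    refine ENNReal.le_of_forall_pos_le_add ?_
    intro ε hε _
    have hlt : L < L + ε := ENNReal.lt_add_right hL (by simpa using hε.ne')
    have hfr : ∃ᶠ n in atTop, Rrate ρ (empMeas n x) Q D < L + ε :=
      frequently_lt_of_liminf_lt (by isBoundedDefault) hlt
    refine liminf_le_of_frequently_le' ?_
    refine (hfr.and_eventually (eventually_gt_atTop 0)).mono ?_
    rintro n ⟨hn, hn0⟩
    have := emp_prob hn0 x
    refine (lintegral_phiF_le hρm hρ0 Q (empMeas n x) hD (by positivity)).trans ?_
    calc _ ≤ (L + ε) + ENNReal.ofReal (q : ℝ) * ENNReal.ofReal D := by gcongr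
      _ = _ := by ring
  refine dual_hard hρm hρ0 Q P hD hL ?_
  intro l hl
  have hc : Tendsto (fun r : ℝ => L + ENNReal.ofReal r * ENNReal.ofReal D) (𝓝[>] l)
      (𝓝 (L + ENNReal.ofReal l * ENNReal.ofReal D)) := by
    refine Tendsto.mono_left ?_ nhdsWithin_le_nhds
    refine Continuous.tendsto (f := fun r : ℝ => L + ENNReal.ofReal r * ENNReal.ofReal D) ?_ l
    refine continuous_const.add ?_
    refine continuous_iff_continuousAt.2 fun r => ?_
    exact ENNReal.Tendsto.mul_const (ENNReal.continuous_ofReal.tendsto r)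
      (Or.inr ENNReal.ofReal_ne_top)
  refine ge_of_tendsto hc ?_
  filter_upwards [self_mem_nhdsWithin] with r hr
  obtain ⟨q, hq1, hq2⟩ := exists_rat_btwn (show l < r from hr)
  have hq0 : (0 : ℚ) ≤ q := by exact_mod_cast (hl.trans hq1).le
  lift q to ℚ≥0 using hq0
  have hqq := hq q
  have hcast : ((q : ℚ) : ℝ) = (q : ℝ) := by norm_cast
  rw [hcast] at hq1 hq2
  calc _ ≤ ∫⁻ y, ENNReal.ofReal (phiF ρ Q (q : ℝ) y) ∂P :=
        lintegral_mono fun y => ENNReal.ofReal_le_ofReal (phiF_mono hρm hρ0 Q hl.le hq1.le y)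
    _ ≤ _ := hqq
    _ ≤ _ := by gcongr

lemma rate_upper (hρm : Measurable ρ)
    [IsProbabilityMeasure P] (Q : Measure T) [IsProbabilityMeasure Q]
    [IsProbabilityMeasure Psrc] (hErg : Ergodic shiftSeq Psrc)
    (hP1 : Psrc.map (fun x => x 0) = P) {D : ℝ} (hD : 0 ≤ D)
    {W : Measure (S × T)} (hW : W ∈ distSet ρ P D) (hfin : relEnt W (P.prod Q) ≠ ∞) :
    ∀ᵐ x ∂Psrc, liminf (fun n => Rrate ρ (empMeas n x) Q D) atTop ≤ relEnt W (P.prod Q) := by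
  obtain ⟨w, hw, hm, hd, hk⟩ := exists_density hρm P Q hD hW hfin
  set f : S → ℝ≥0∞ := fun x => ∫⁻ y, ENNReal.ofReal (ρ (x,y)) * w (x,y) ∂Q with hf
  set h : S → ℝ≥0∞ := fun x => ∫⁻ y, ENNReal.ofReal (InformationTheory.klFun (w (x,y)).toReal) ∂Q
    with hh
  have hfm : Measurable f := (hρm.ennreal_ofReal.mul hw).lintegral_prod_right'
  have hhm : Measurable h :=
    ((InformationTheory.measurable_klFun.comp hw.ennreal_toReal).ennreal_ofReal).lintegral_prod_right'
  have hf_ne : ∫⁻ x, f x ∂P ≠ ∞ := (hd.trans_lt ENNReal.ofReal_lt_top).ne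
  have hffin : ∀ᵐ x ∂P, f x ≠ ∞ := by
    filter_upwards [ae_lt_top hfm hf_ne] with x hx using hx.ne
  have e1 := src_ae hErg hP1 hm
  have e2 := src_ae hErg hP1 hffin
  have e3 : ∀ᵐ x ∂Psrc, Tendsto (fun n : ℕ => ∫⁻ y, h y ∂(empMeas n x)) atTop
      (𝓝 (relEnt W (P.prod Q))) := by
    have e := ergodic_lintegral_tendsto hErg (hhm.comp (measurable_pi_apply 0))
      (by simp only [Function.comp_def]; rw [src_lintegral hP1 hhm, hk]; exact hfin)
    filter_upwards [e] with x hx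
    simp only [Function.comp_def] at hx
    rw [src_lintegral hP1 hhm, hk] at hx
    simp only [lintegral_emp hhm]
    exact hx
  have hsrcne : ∫⁻ x, f (x 0) ∂Psrc ≠ ∞ := by rw [src_lintegral hP1 hfm]; exact hf_ne
  have hfm0 : Measurable fun x : ℕ → S => f (x 0) := hfm.comp (measurable_pi_apply 0)
  have hfi : Integrable (fun x : ℕ → S => (f (x 0)).toReal) Psrc :=
    integrable_toReal_of_lintegral_ne_top hfm0.aemeasurable hsrcne
  have e4 := ergodic_frequently_nonpos hErg (g := fun x : ℕ → S => (f (x 0)).toReal - D)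
    (hfm0.ennreal_toReal.sub measurable_const) (hfi.sub (integrable_const _)) (by
      rw [integral_sub hfi (integrable_const _),
        integral_toReal hfm0.aemeasurable (ae_lt_top hfm0 hsrcne), src_lintegral hP1 hfm]
      have := ENNReal.toReal_mono ENNReal.ofReal_ne_top hd
      rw [ENNReal.toReal_ofReal hD] at this
      simpa using this)
  filter_upwards [e1, e2, e3, e4] with x x1 x2 x3 x4
  rw [← x3.liminf_eq]
  refine ENNReal.le_of_forall_pos_le_add ?_
  intro ε hε hlt
  rw [x3.liminf_eq] at hlt ⊢
  have hev : ∀ᶠ n : ℕ in atTop, ∫⁻ y, h y ∂(empMeas n x) < relEnt W (P.prod Q) + ε :=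
    x3.eventually_lt_const (ENNReal.lt_add_right hfin (by simpa using hε.ne'))
  refine liminf_le_of_frequently_le' ?_
  refine (x4.and_eventually (hev.and (eventually_gt_atTop 0))).mono ?_
  rintro n ⟨hn, hn1, hn0⟩
  have := emp_prob hn0 x
  refine (Rrate_le_of_density hρm (empMeas n x) Q hD hw ?_ ?_).trans hn1.le
  · exact emp_ae (p := fun s => ∫⁻ y, w (s,y) ∂Q = 1)
      (hw.lintegral_prod_right' (measurableSet_singleton 1)) n x x1
  · change ∫⁻ s, f s ∂(empMeas n x) ≤ _
    rw [lintegral_emp hfm, birk_emp]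
    rw [birk_emp (fun s => (f s).toReal - D)] at hn
    have hs : ∑ k ∈ Finset.range n, f (x k)
        = ENNReal.ofReal (∑ k ∈ Finset.range n, (f (x k)).toReal) := by
      rw [ENNReal.ofReal_sum_of_nonneg (fun _ _ => ENNReal.toReal_nonneg)]
      exact Finset.sum_congr rfl fun k _ => (ENNReal.ofReal_toReal (x2 k)).symm
    have hle : ∑ k ∈ Finset.range n, (f (x k)).toReal ≤ n * D := by
      simpa [Finset.sum_sub_distrib] using hn
    rw [hs]
    calc _ ≤ (n : ℝ≥0∞)⁻¹ * ENNReal.ofReal (n * D) := by gcongr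
      _ = (n : ℝ≥0∞)⁻¹ * (n * ENNReal.ofReal D) := by
        rw [ENNReal.ofReal_mul (by positivity), ENNReal.ofReal_natCast]
      _ = ENNReal.ofReal D := by
        rw [← mul_assoc, ENNReal.inv_mul_cancel (by simpa using hn0.ne') (by simp), one_mul]
      _ ≤ _ := le_rfl

lemma Rrate_neg {D : ℝ} (hD : D < 0) (P : Measure S) (Q : Measure T) : Rrate ρ P Q D = ∞ := by
  have : distSet ρ P D = ∅ := by
    ext W
    simp only [distSet, mem_ofPred_eq, mem_empty_iff_false, iff_false]
    rintro ⟨-, -, h⟩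
    have h0 : (0 : EReal) ≤ (D : EReal) := le_trans (EReal.coe_ennreal_nonneg _) h
    exact absurd (EReal.coe_nonneg.1 h0) (not_le.2 hD)
  simp [Rrate, this]

end final

/-- for a stationary ergodic source with marginal `P`,
`liminf_n R(P_{X_1^n}, Q, D) = R(P,Q,D)` almost surely, for every `D`, where
`P_{x_1^n}` is the empirical distribution of `x_1^n`. -/
theorem stmt9 {S T : Type*} [MeasurableSpace S] [StandardBorelSpace S]
    [MeasurableSpace T] [StandardBorelSpace T]
    (ρ : S × T → ℝ) (hρm : Measurable ρ) (hρ0 : ∀ z, 0 ≤ ρ z)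
    (P : Measure S) (Q : Measure T) [IsProbabilityMeasure P] [IsProbabilityMeasure Q]
    (Psrc : Measure (ℕ → S)) [IsProbabilityMeasure Psrc]
    (hErg : Ergodic shiftSeq Psrc)
    (hP1 : Psrc.map (fun x => x 0) = P) (D : ℝ) :
    ∀ᵐ x ∂Psrc, liminf (fun n => Rrate ρ (empMeas n x) Q D) atTop = Rrate ρ P Q D := by
  rcases lt_or_ge D 0 with hD | hD
  · simp [Rrate_neg hD]
  have up : ∀ᵐ x ∂Psrc,
      liminf (fun n => Rrate ρ (empMeas n x) Q D) atTop ≤ Rrate ρ P Q D := by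
    by_cases hR : Rrate ρ P Q D = ∞
    · simp [hR]
    have hj : ∀ j : ℕ, ∃ W ∈ distSet ρ P D,
        relEnt W (P.prod Q) < Rrate ρ P Q D + ((j : ℝ≥0∞) + 1)⁻¹ := by
      intro j
      have : Rrate ρ P Q D < Rrate ρ P Q D + ((j : ℝ≥0∞) + 1)⁻¹ :=
        ENNReal.lt_add_right hR (by simp)
      conv_lhs at this => rw [Rrate]
      simpa only [iInf_lt_iff, exists_prop] using this
    have hall : ∀ᵐ x ∂Psrc, ∀ j : ℕ, liminf (fun n => Rrate ρ (empMeas n x) Q D) atTop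
        ≤ Rrate ρ P Q D + ((j : ℝ≥0∞) + 1)⁻¹ := by
      rw [ae_all_iff]
      intro j
      obtain ⟨W, hW, hlt⟩ := hj j
      filter_upwards [rate_upper hρm Q hErg hP1 hD hW (ne_top_of_lt hlt)] with x hx
      exact hx.trans hlt.le
    filter_upwards [hall] with x hx
    have ht : Tendsto (fun j : ℕ => Rrate ρ P Q D + ((j : ℝ≥0∞) + 1)⁻¹) atTop
        (𝓝 (Rrate ρ P Q D + 0)) := by
      refine tendsto_const_nhds.add ?_
      have := (tendsto_add_atTop_iff_nat 1).2 ENNReal.tendsto_inv_nat_nhds_zero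
      simpa using this
    rw [add_zero] at ht
    exact ge_of_tendsto' ht hx
  filter_upwards [up, rate_lower hρm hρ0 Q hErg hP1 hD] with x h1 h2
  exact le_antisymm h1 h2

end
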